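/- arXiv:math/0406364 — 6 statements merged into one kernel-verified Lean document; each statement's English description precedes it below -/
import Mathlib

section
/- Let 𝒳 be a compact metric space and let (μ_n)_{n≥1} be a thinning-invariant sequence of Borel probability measures, μ_n on 𝒳^n. Then there exists a Borel probability measure P on the space M₁([0,1]×𝒳) of Borel probability measures on [0,1]×𝒳 (with the topology of weak convergence), concentrated on the set 𝒦 of measures whose first marginal is Lebesgue measure, such that for every n ≥ 1 and all Borel sets A₁,…,A_n ⊆ 𝒳: μ_n(A₁×⋯×A_n) = ∫_𝒦 [ n! ∫_{Δⁿ} ∏_{i=1}^n ν_{t_i}(A_i) dt₁⋯dt_n ] P(dν), where for ν ∈ 𝒦, (ν_t)_{t∈[0,1]} denotes a disintegration of ν over its first (Lebesgue) marginal, i.e. a Borel family of probability measures on 𝒳 with ν(dt⊗dx) = dt ν_t(dx), and Δⁿ = {(t₁,…,t_n) : 0 < t₁ < ⋯ < t_n < 1}. -/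
open MeasureTheory
open scoped ENNReal

/-- The thinning transition `T^n_k : M₁(𝒳ⁿ) → M₁(𝒳ᵏ)`: the average over all strictly
increasing index maps `ι : Fin k → Fin n` of the pushforward of `μ` under `x ↦ x ∘ ι`. -/
noncomputable def thinTrans {X : Type*} [MeasurableSpace X] (k n : ℕ)
    (μ : Measure (Fin n → X)) : Measure (Fin k → X) :=
  ((n.choose k : ℝ≥0∞))⁻¹ •
    Measure.sum (fun ι : {ι : Fin k → Fin n // StrictMono ι} =>
      Measure.map (fun x => x ∘ ι.1) μ)

/-- The open simplex `Δⁿ = {0 < t₁ < ⋯ < t_n < 1}` inside `ℝⁿ`. -/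
def simplexSet (n : ℕ) : Set (Fin n → ℝ) :=
  {t | StrictMono t ∧ ∀ i, t i ∈ Set.Ioo (0 : ℝ) 1}

/-- The set `𝒦` of probability measures on `[0,1] × 𝒳` (realized as measures on `ℝ × 𝒳`)
whose first marginal is Lebesgue measure on `[0,1]`. -/
def Kset (X : Type*) [MeasurableSpace X] : Set (Measure (ℝ × X)) :=
  {ν | IsProbabilityMeasure ν ∧ ν.fst = volume.restrict (Set.Icc (0 : ℝ) 1)}

open ProbabilityTheory Filter Topology Set BoundedContinuousFunction
open scoped NNReal

/-- Lebesgue measure on the unit interval, as a measure on `ℝ`. -/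
noncomputable abbrev unitLebesgue : Measure ℝ := volume.restrict (Icc (0 : ℝ) 1)

instance isProbabilityMeasure_unitLebesgue : IsProbabilityMeasure unitLebesgue :=
  ⟨by simp⟩

/-- Probability measures on `ℝ × X` whose first marginal is Lebesgue measure on `[0,1]`. -/
def UniformMarginal (X : Type*) [MeasurableSpace X] : Type _ :=
  {ν : ProbabilityMeasure (ℝ × X) // (ν : Measure (ℝ × X)).fst = unitLebesgue}

namespace UniformMarginal

section

variable {X : Type*} [MeasurableSpace X]

/-- The underlying probability measure. -/
def toProb (ν : UniformMarginal X) : ProbabilityMeasure (ℝ × X) := ν.1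

lemma fst_toProb (ν : UniformMarginal X) :
    (ν.toProb : Measure (ℝ × X)).fst = unitLebesgue := ν.2

lemma map_fst_pi (ν : UniformMarginal X) (n : ℕ) :
    (Measure.pi fun _ : Fin n ↦ (ν.toProb : Measure (ℝ × X))).map (fun e i ↦ (e i).1) =
      Measure.pi fun _ ↦ unitLebesgue := by
  have h := ν.fst_toProb
  rw [Measure.fst] at h
  have : ∀ i : Fin n, SigmaFinite
      ((fun _ : Fin n ↦ (ν.toProb : Measure (ℝ × X))) i |>.map Prod.fst) := by
    intro i; simp only [h]; infer_instance
  rw [Measure.pi_map_pi (f := fun _ ↦ Prod.fst) (fun _ ↦ measurable_fst.aemeasurable)]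
  simp only [h]

end

variable {X : Type*} [TopologicalSpace X] [PolishSpace X] [MeasurableSpace X] [BorelSpace X]

/-- The topology of weak convergence. -/
instance : TopologicalSpace (UniformMarginal X) :=
  inferInstanceAs (TopologicalSpace
    {ν : ProbabilityMeasure (ℝ × X) // (ν : Measure (ℝ × X)).fst = unitLebesgue})

instance : TopologicalSpace.MetrizableSpace (UniformMarginal X) :=
  (IsEmbedding.subtypeVal (X := ProbabilityMeasure (ℝ × X))).metrizableSpace

instance : MeasurableSpace (UniformMarginal X) := borel _

instance : BorelSpace (UniformMarginal X) := ⟨rfl⟩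

lemma isClosed_setOf_fst_eq :
    IsClosed {ν : ProbabilityMeasure (ℝ × X) | (ν : Measure (ℝ × X)).fst = unitLebesgue} := by
  have h : {ν : ProbabilityMeasure (ℝ × X) | (ν : Measure (ℝ × X)).fst = unitLebesgue} =
      {ν | ν.map (continuous_fst (X := ℝ) (Y := X)).measurable.aemeasurable =
        ⟨unitLebesgue, inferInstance⟩} := by
    ext ν
    exact (Subtype.ext_iff (a1 := ν.map (continuous_fst (X := ℝ) (Y := X)).measurable.aemeasurable)
      (a2 := ⟨unitLebesgue, inferInstance⟩)).symm
  rw [h]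
  exact isClosed_eq (ProbabilityMeasure.continuous_map continuous_fst) continuous_const

instance [CompactSpace X] : CompactSpace (UniformMarginal X) := by
  refine isCompact_iff_compactSpace.1 ?_
  change IsCompact {ν : ProbabilityMeasure (ℝ × X) |
    (ν : Measure (ℝ × X)).fst = unitLebesgue}
  rw [← isClosed_setOf_fst_eq.closure_eq]
  refine isCompact_closure_of_isTightMeasureSet ?_
  refine isTightMeasureSet_iff_exists_isCompact_measure_compl_le.2 fun ε _ ↦
    ⟨Icc 0 1 ×ˢ univ, isCompact_Icc.prod isCompact_univ, ?_⟩
  rintro _ ⟨ν, hν, rfl⟩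
  have h : (Icc (0 : ℝ) 1 ×ˢ (univ : Set X))ᶜ = Prod.fst ⁻¹' (Icc 0 1)ᶜ := by
    ext; simp
  rw [h, ← Measure.fst_apply measurableSet_Icc.compl, hν]
  simp

lemma continuous_toProb : Continuous (toProb : UniformMarginal X → _) :=
  continuous_subtype_val

end UniformMarginal

/-- A continuous family of probability measures is measurable for the Giry σ-algebra. -/
lemma Continuous.measurable_toMeasure {Y Ω : Type*} [TopologicalSpace Y] [MeasurableSpace Y]
    [OpensMeasurableSpace Y] [TopologicalSpace Ω] [MeasurableSpace Ω] [BorelSpace Ω]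
    [HasOuterApproxClosed Ω] {μ : Y → ProbabilityMeasure Ω} (hμ : Continuous μ) :
    Measurable fun y ↦ (μ y : Measure Ω) := by
  refine Measurable.measure_of_isPiSystem_of_isProbabilityMeasure
    ((BorelSpace.measurable_eq (α := Ω)).trans borel_eq_generateFrom_isClosed)
    isPiSystem_isClosed fun F hF ↦ ?_
  refine measurable_of_tendsto_metrizable
    (f := fun n y ↦ ∫⁻ x, (IsClosed.apprSeq hF n x : ℝ≥0∞) ∂(μ y : Measure Ω)) (fun n ↦ ?_)
    (tendsto_pi_nhds.2 fun y ↦ HasOuterApproxClosed.tendsto_lintegral_apprSeq hF _)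
  exact (ProbabilityMeasure.continuous_iff_forall_continuous_lintegral.1 hμ _).measurable

lemma measurableSet_simplexSet (n : ℕ) : MeasurableSet (simplexSet n) := by
  have h : simplexSet n = (⋂ i, ⋂ j, ⋂ _ : i < j, {t | t i < t j}) ∩
      ⋂ i, {t | t i ∈ Ioo (0 : ℝ) 1} := by
    ext t
    simp [simplexSet, StrictMono]
  rw [h]
  refine MeasurableSet.inter ?_ ?_
  · exact .iInter fun i ↦ .iInter fun j ↦ .iInter fun _ ↦
      measurableSet_lt (measurable_pi_apply i) (measurable_pi_apply j)
  · exact .iInter fun i ↦ measurable_pi_apply i measurableSet_Ioo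

/-- The function on `(ℝ × X)ⁿ` that evaluates `f` on the `X`-coordinates, cut off to those points
whose `ℝ`-coordinates lie in the open simplex. -/
noncomputable def simplexTest {X : Type*} {n : ℕ} (f : (Fin n → X) → ℝ) (e : Fin n → ℝ × X) : ℝ :=
  (simplexSet n).indicator 1 (fun i ↦ (e i).1) * f fun i ↦ (e i).2

section

variable {X : Type*} [TopologicalSpace X] [PolishSpace X] [MeasurableSpace X] [BorelSpace X]
  {n : ℕ}

lemma measurable_simplexTest {f : (Fin n → X) → ℝ} (hf : Continuous f) :
    Measurable (simplexTest f) := by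
  refine Measurable.mul ?_ (hf.measurable.comp (by fun_prop))
  exact (measurable_one.indicator (measurableSet_simplexSet n)).comp (by fun_prop)

lemma UniformMarginal.continuous_integral_simplexTest (f : (Fin n → X) →ᵇ ℝ) :
    Continuous fun ν : UniformMarginal X ↦
      ∫ e, simplexTest f e ∂(Measure.pi fun _ ↦ (ν.toProb : Measure (ℝ × X))) := by
  refine continuous_of_uniform_approx_of_continuous fun u hu ↦ ?_
  obtain ⟨ε, hε, hεu⟩ := Metric.mem_uniformity_dist.1 hu
  have hint : Integrable ((simplexSet n).indicator (1 : (Fin n → ℝ) → ℝ))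
      (Measure.pi fun _ ↦ unitLebesgue) :=
    (integrable_const (1 : ℝ)).indicator (measurableSet_simplexSet n)
  have hC : 0 < ‖f‖ + 1 := by positivity
  obtain ⟨g, hg, hgi⟩ := hint.exists_boundedContinuous_integral_sub_le
    (show 0 < ε / 2 / (‖f‖ + 1) by positivity)
  let G : (Fin n → ℝ × X) →ᵇ ℝ :=
    (g.compContinuous ⟨fun e i ↦ (e i).1, by fun_prop⟩) *
      f.compContinuous ⟨fun e i ↦ (e i).2, by fun_prop⟩
  refine ⟨fun ν ↦ ∫ e, G e ∂(Measure.pi fun _ ↦ (ν.toProb : Measure (ℝ × X))), ?_, fun ν ↦ ?_⟩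
  · exact (ProbabilityMeasure.continuous_integral_boundedContinuousFunction G).comp
      (ProbabilityMeasure.continuous_pi.comp
        (_root_.continuous_pi fun _ : Fin n ↦ continuous_toProb))
  apply hεu
  set m := Measure.pi fun _ : Fin n ↦ (ν.toProb : Measure (ℝ × X))
  have hmeas : Measurable fun (e : Fin n → ℝ × X) i ↦ (e i).1 := by fun_prop
  have hmap : m.map (fun e i ↦ (e i).1) = Measure.pi fun _ ↦ unitLebesgue := ν.map_fst_pi n
  have hint' : Integrable (fun e : Fin n → ℝ × X ↦
      (simplexSet n).indicator (1 : (Fin n → ℝ) → ℝ) (fun i ↦ (e i).1) - g fun i ↦ (e i).1) m := by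
    have := hint.sub hgi
    rw [← hmap] at this
    exact this.comp_measurable hmeas
  have h1 : Integrable (simplexTest f) m := by
    refine Integrable.of_bound (C := ‖f‖) (measurable_simplexTest f.continuous).aestronglyMeasurable
      (ae_of_all _ fun e ↦ ?_)
    rw [simplexTest, norm_mul]
    refine (mul_le_mul (b := 1) (d := ‖f‖) ?_ (f.norm_coe_le_norm _) (by positivity)
      (by positivity)).trans (by simp)
    by_cases h : (fun i ↦ (e i).1) ∈ simplexSet n <;> simp [h]
  rw [dist_eq_norm, ← integral_sub h1 (G.integrable m)]
  refine (norm_integral_le_integral_norm _).trans_lt ?_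
  calc ∫ e, ‖simplexTest f e - G e‖ ∂m
      ≤ ∫ e, ‖(simplexSet n).indicator (1 : (Fin n → ℝ) → ℝ) (fun i ↦ (e i).1)
          - g fun i ↦ (e i).1‖ * (‖f‖ + 1) ∂m := by
        refine integral_mono (h1.sub (G.integrable m)).norm (hint'.norm.mul_const _) fun e ↦ ?_
        have : simplexTest f e - G e = ((simplexSet n).indicator (1 : (Fin n → ℝ) → ℝ)
          (fun i ↦ (e i).1) - g fun i ↦ (e i).1) * f fun i ↦ (e i).2 := by
          simp [simplexTest, G, sub_mul]
        simp only [this, norm_mul]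
        gcongr
        exact (f.norm_coe_le_norm _).trans (by linarith)
    _ = (∫ t, ‖(simplexSet n).indicator (1 : (Fin n → ℝ) → ℝ) t - g t‖
          ∂(Measure.pi fun _ ↦ unitLebesgue)) * (‖f‖ + 1) := by
        rw [integral_mul_const, ← hmap, integral_map hmeas.aemeasurable]
        rw [hmap]
        exact (hint.sub hgi).norm.aestronglyMeasurable
    _ ≤ ε / 2 / (‖f‖ + 1) * (‖f‖ + 1) := by gcongr
    _ < ε := by rw [div_mul_cancel₀ _ hC.ne']; linarith

end

/-- The index of the cell of the regular partition of `[0,1]` into `M + 1` intervals that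
contains `t`. -/
noncomputable def gridIndex (M : ℕ) (t : ℝ) : Fin (M + 1) :=
  ⟨min ⌊((M : ℝ) + 1) * t⌋₊ M, by omega⟩

lemma monotone_gridIndex (M : ℕ) : Monotone (gridIndex M) := by
  intro s t h
  simp only [gridIndex, Fin.mk_le_mk]
  gcongr

lemma measurable_gridIndex (M : ℕ) : Measurable (gridIndex M) :=
  (monotone_gridIndex M).measurable

lemma map_gridIndex_singleton (M : ℕ) (j : Fin (M + 1)) :
    unitLebesgue.map (gridIndex M) {j} = ((M : ℝ≥0∞) + 1)⁻¹ := by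
  have hN : (0 : ℝ) < (M : ℝ) + 1 := by positivity
  have hj : (j : ℝ) + 1 ≤ (M : ℝ) + 1 := by exact_mod_cast j.2
  have hset : gridIndex M ⁻¹' {j} ∩ Ico 0 1 =
      Ico ((j : ℝ) / (M + 1)) (((j : ℝ) + 1) / (M + 1)) := by
    ext t
    simp only [mem_inter_iff, mem_preimage, mem_singleton_iff, mem_Ico, gridIndex, Fin.ext_iff]
    rw [div_le_iff₀ hN, lt_div_iff₀ hN, mul_comm t]
    constructor
    · rintro ⟨h, h0, h1⟩
      have hlt : ⌊((M : ℝ) + 1) * t⌋₊ < M + 1 := by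
        rw [Nat.floor_lt (by positivity)]
        push_cast
        nlinarith
      rw [min_eq_left (by omega)] at h
      exact (Nat.floor_eq_iff (by positivity)).1 h
    · rintro ⟨h0, h1⟩
      have ht : 0 ≤ t := by
        by_contra! h
        have : (0 : ℝ) ≤ j := by positivity
        nlinarith
      refine ⟨?_, ht, by nlinarith⟩
      rw [(Nat.floor_eq_iff (by positivity)).2 ⟨h0, h1⟩]
      exact min_eq_left (by omega)
  rw [Measure.map_apply (measurable_gridIndex M) (measurableSet_singleton j), unitLebesgue,
    ← restrict_Ico_eq_restrict_Icc,
    Measure.restrict_apply (measurable_gridIndex M (measurableSet_singleton j)), hset,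
    Real.volume_Ico, ← sub_div, add_sub_cancel_left, one_div, ENNReal.ofReal_inv_of_pos hN,
    ENNReal.ofReal_add (by positivity) zero_le_one]
  simp

lemma eventually_strictMono_gridIndex {n : ℕ} {t : Fin n → ℝ} (ht : t ∈ simplexSet n) :
    ∀ᶠ M in atTop, StrictMono fun i ↦ gridIndex M (t i) := by
  have h : ∀ i j, i < j → ∀ᶠ M in atTop, gridIndex M (t i) < gridIndex M (t j) := by
    intro i j hij
    have hlt : 0 < t j - t i := sub_pos.2 (ht.1 hij)
    obtain ⟨m, hm⟩ := exists_nat_gt (1 / (t j - t i))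
    filter_upwards [eventually_ge_atTop m] with M hM
    have hM' : (m : ℝ) ≤ M := by exact_mod_cast hM
    have h1 : 1 < ((M : ℝ) + 1) * (t j - t i) := by
      rw [div_lt_iff₀ hlt] at hm
      nlinarith
    have h0 : 0 ≤ ((M : ℝ) + 1) * t i := mul_nonneg (by positivity) (ht.2 i).1.le
    have h2 : ⌊((M : ℝ) + 1) * t i⌋₊ + 1 ≤ ⌊((M : ℝ) + 1) * t j⌋₊ := by
      rw [← Nat.floor_add_one h0]
      exact Nat.floor_mono (by linarith)
    have h3 : ⌊((M : ℝ) + 1) * t j⌋₊ < M + 1 := by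
      have hj := (ht.2 j).2
      rw [Nat.floor_lt (mul_nonneg (by positivity) (ht.2 j).1.le)]
      push_cast
      nlinarith [(M.cast_nonneg : (0 : ℝ) ≤ M)]
    simp only [gridIndex, Fin.mk_lt_mk]
    omega
  filter_upwards [eventually_all.2 fun i ↦ eventually_all.2 fun j ↦
    (eventually_all (ι := i < j)).2 fun hij ↦ h i j hij] with M hM i j hij
  exact hM i j hij

lemma ae_mem_simplexSet_of_strictMono (n : ℕ) :
    ∀ᵐ t ∂(Measure.pi fun _ : Fin n ↦ unitLebesgue), StrictMono t → t ∈ simplexSet n := by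
  have h : ∀ i : Fin n, ∀ᵐ t ∂(Measure.pi fun _ : Fin n ↦ unitLebesgue), t i ∈ Ioo (0 : ℝ) 1 := by
    intro i
    refine (Measure.tendsto_eval_ae_ae (μ := fun _ : Fin n ↦ unitLebesgue) (i := i)).eventually ?_
    rw [unitLebesgue, ← restrict_Ioo_eq_restrict_Icc]
    exact ae_restrict_mem measurableSet_Ioo
  filter_upwards [ae_all_iff.2 h] with t ht hm
  exact ⟨hm, ht⟩

section

variable {X : Type*} [MeasurableSpace X]

lemma measurable_comp_gridIndex (M n : ℕ) :
    Measurable fun (p : (Fin (M + 1) → X) × (Fin n → ℝ)) i ↦ p.1 (gridIndex M (p.2 i)) := by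
  have h : Measurable fun q : (Fin (M + 1) → X) × Fin (M + 1) ↦ q.1 q.2 :=
    measurable_from_prod_countable_left fun j ↦ measurable_pi_apply j
  refine measurable_pi_lambda _ fun i ↦ ?_
  exact h.comp (measurable_fst.prodMk
    ((measurable_gridIndex M).comp ((measurable_pi_apply i).comp measurable_snd)))

lemma integral_thinTrans {k n : ℕ} (μ : Measure (Fin n → X)) [IsFiniteMeasure μ]
    {f : (Fin k → X) → ℝ} (hf : Measurable f) {C : ℝ} (hC : ∀ x, ‖f x‖ ≤ C) :
    ∫ x, f x ∂(thinTrans k n μ) =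
      ((n.choose k : ℝ))⁻¹ * ∑ ι : {ι : Fin k → Fin n // StrictMono ι}, ∫ x, f (x ∘ ι.1) ∂μ := by
  have hm : ∀ ι : Fin k → Fin n, Measurable fun x : Fin n → X ↦ x ∘ ι := fun ι ↦
    measurable_pi_lambda _ fun i ↦ measurable_pi_apply (ι i)
  rw [thinTrans, integral_smul_measure, Measure.sum_fintype, integral_finsetSum_measure]
  · simp [integral_map (hm _).aemeasurable hf.aestronglyMeasurable]
  · exact fun _ _ ↦ .of_bound hf.aestronglyMeasurable C (ae_of_all _ hC)

/-- The uniform distribution on multi-indices of the grid, restricted to strictly increasing ones,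
is proportional to a thinning. -/
lemma integral_strictMono_gridIndex {M n : ℕ} (h : (Fin n → Fin (M + 1)) → ℝ) :
    ∫ t, {ι | StrictMono ι}.indicator h (fun i ↦ gridIndex M (t i))
        ∂(Measure.pi fun _ : Fin n ↦ unitLebesgue) =
      (((M : ℝ) + 1) ^ n)⁻¹ * ∑ ι : {ι : Fin n → Fin (M + 1) // StrictMono ι}, h ι.1 := by
  classical
  have : IsProbabilityMeasure (unitLebesgue.map (gridIndex M)) :=
    Measure.isProbabilityMeasure_map (measurable_gridIndex M).aemeasurable
  have hmap := Measure.pi_map_pi (μ := fun _ : Fin n ↦ unitLebesgue) (f := fun _ ↦ gridIndex M)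
    fun _ ↦ (measurable_gridIndex M).aemeasurable
  have hmeas : Measurable fun (t : Fin n → ℝ) i ↦ gridIndex M (t i) :=
    measurable_pi_lambda _ fun i ↦ (measurable_gridIndex M).comp (measurable_pi_apply i)
  have hs : ∀ ι : Fin n → Fin (M + 1),
      (Measure.pi fun _ : Fin n ↦ unitLebesgue.map (gridIndex M)).real {ι} =
        (((M : ℝ) + 1) ^ n)⁻¹ := by
    intro ι
    rw [Measure.real, Measure.pi_singleton]
    simp only [map_gridIndex_singleton, Finset.prod_const, Finset.card_univ, Fintype.card_fin,
      ENNReal.toReal_pow, ENNReal.toReal_inv, inv_pow]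
    rw [ENNReal.toReal_add (by simp) (by simp)]
    simp
  rw [← integral_map (f := {ι | StrictMono ι}.indicator h) hmeas.aemeasurable
    (measurable_of_countable _).aestronglyMeasurable, hmap, integral_fintype .of_finite]
  simp only [hs, smul_eq_mul, ← Finset.mul_sum]
  congr 1
  simp only [Set.indicator_apply, mem_ofPred_eq]
  rw [← Finset.sum_filter, ← Finset.sum_subtype_eq_sum_filter]
  exact Finset.sum_congr (by ext; simp) fun _ _ ↦ rfl

end

lemma tendsto_choose_div_pow (n : ℕ) :
    Tendsto (fun M : ℕ ↦ ((M + 1).choose n : ℝ) / ((M : ℝ) + 1) ^ n) atTop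
      (𝓝 ((n.factorial : ℝ)⁻¹)) := by
  have h : Tendsto (fun m : ℕ ↦ (m.choose n : ℝ) / (m : ℝ) ^ n) atTop
      (𝓝 ((n.factorial : ℝ)⁻¹)) := by
    refine ((isEquivalent_choose n).div (Asymptotics.IsEquivalent.refl
      (u := fun m : ℕ ↦ (m : ℝ) ^ n))).symm.tendsto_nhds (tendsto_const_nhds.congr' ?_)
    filter_upwards [eventually_gt_atTop 0] with m hm
    have hm' : (m : ℝ) ≠ 0 := by exact_mod_cast hm.ne'
    rw [Pi.div_apply]
    field_simp
  simpa using (tendsto_add_atTop_iff_nat 1).2 h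

section

variable {X : Type*} [MeasurableSpace X]

lemma measurable_graph_gridIndex (M : ℕ) (x : Fin (M + 1) → X) :
    Measurable fun t ↦ (t, x (gridIndex M t)) :=
  measurable_id.prodMk ((measurable_of_countable x).comp (measurable_gridIndex M))

/-- The measure carried by the graph of the step function on the regular grid with values `x`. -/
noncomputable def stepMeasure (M : ℕ) (x : Fin (M + 1) → X) : UniformMarginal X :=
  have h := measurable_graph_gridIndex M x
  ⟨⟨unitLebesgue.map fun t ↦ (t, x (gridIndex M t)),
    Measure.isProbabilityMeasure_map h.aemeasurable⟩, by
      change (unitLebesgue.map fun t ↦ (t, x (gridIndex M t))).fst = unitLebesgue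
      rw [Measure.fst, Measure.map_map measurable_fst h]
      exact Measure.map_id⟩

lemma toMeasure_stepMeasure (M : ℕ) (x : Fin (M + 1) → X) :
    ((stepMeasure M x).toProb : Measure (ℝ × X)) =
      unitLebesgue.map fun t ↦ (t, x (gridIndex M t)) := rfl

end

section

variable {X : Type*} [TopologicalSpace X] [PolishSpace X] [MeasurableSpace X] [BorelSpace X]

/-- Averaging the thinning identity over uniform random points of the simplex recovers the `n`-th
marginal in the limit of a fine grid. -/
lemma tendsto_integral_simplex_gridIndex (μ : (n : ℕ) → Measure (Fin n → X))
    (hprob : ∀ n, 1 ≤ n → IsProbabilityMeasure (μ n))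
    (hthin : ∀ k n, 1 ≤ k → k ≤ n → thinTrans k n (μ n) = μ k)
    {n : ℕ} (hn : 1 ≤ n) (f : (Fin n → X) →ᵇ ℝ) :
    Tendsto (fun M ↦ ∫ x, ∫ t, (simplexSet n).indicator 1 t * f (fun i ↦ x (gridIndex M (t i)))
        ∂(Measure.pi fun _ : Fin n ↦ unitLebesgue) ∂(μ (M + 1)))
      atTop (𝓝 ((n.factorial : ℝ)⁻¹ * ∫ x, f x ∂(μ n))) := by
  set m := Measure.pi fun _ : Fin n ↦ unitLebesgue
  let h (M : ℕ) (ι : Fin n → Fin (M + 1)) : ℝ := ∫ x, f (fun i ↦ x (ι i)) ∂(μ (M + 1))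
  have hh : ∀ M ι, ‖h M ι‖ ≤ ‖f‖ := by
    intro M ι
    have := hprob (M + 1) (by omega)
    simpa using norm_integral_le_of_norm_le_const (μ := μ (M + 1))
      (ae_of_all _ fun x ↦ f.norm_coe_le_norm fun i ↦ x (ι i))
  have hgrid : ∀ M, Measurable fun (t : Fin n → ℝ) i ↦ gridIndex M (t i) := fun M ↦
    measurable_pi_lambda _ fun i ↦ (measurable_gridIndex M).comp (measurable_pi_apply i)
  have hind : ∀ t, ‖(simplexSet n).indicator (1 : (Fin n → ℝ) → ℝ) t‖ ≤ 1 := by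
    intro t
    by_cases ht : t ∈ simplexSet n <;> simp [ht]
  have hbound : ∀ t (y : Fin n → X), ‖(simplexSet n).indicator (1 : (Fin n → ℝ) → ℝ) t * f y‖ ≤
      ‖f‖ := by
    intro t y
    rw [norm_mul]
    exact (mul_le_mul (hind t) (f.norm_coe_le_norm y) (norm_nonneg _) zero_le_one).trans
      (one_mul _).le
  let a (M : ℕ) (t : Fin n → ℝ) : ℝ :=
    (simplexSet n).indicator 1 t * h M fun i ↦ gridIndex M (t i)
  let b (M : ℕ) (t : Fin n → ℝ) : ℝ :=
    {ι | StrictMono ι}.indicator (h M) fun i ↦ gridIndex M (t i)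
  have ha_bound : ∀ M t, ‖a M t‖ ≤ ‖f‖ := by
    intro M t
    rw [norm_mul]
    exact (mul_le_mul (hind t) (hh M _) (norm_nonneg _) zero_le_one).trans (one_mul _).le
  have hb_bound : ∀ M t, ‖b M t‖ ≤ ‖f‖ := fun M t ↦
    (norm_indicator_le_norm_self _ _).trans (hh M _)
  have ha_meas : ∀ M, Measurable (a M) := fun M ↦
    (measurable_one.indicator (measurableSet_simplexSet n)).mul
      ((measurable_of_countable (h M)).comp (hgrid M))
  have hb_meas : ∀ M, Measurable (b M) := fun M ↦
    (measurable_of_countable ({ι | StrictMono ι}.indicator (h M))).comp (hgrid M)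
  have ha_int : ∀ M, Integrable (a M) m := fun M ↦
    .of_bound (ha_meas M).aestronglyMeasurable ‖f‖ (ae_of_all _ (ha_bound M))
  have hb_int : ∀ M, Integrable (b M) m := fun M ↦
    .of_bound (hb_meas M).aestronglyMeasurable ‖f‖ (ae_of_all _ (hb_bound M))
  have hswap : ∀ M, ∫ x, ∫ t, (simplexSet n).indicator 1 t * f (fun i ↦ x (gridIndex M (t i)))
      ∂m ∂(μ (M + 1)) = ∫ t, a M t ∂m := by
    intro M
    have := hprob (M + 1) (by omega)
    rw [integral_integral_swap]
    · simp only [integral_const_mul, a, h]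
    · refine .of_bound (Measurable.aestronglyMeasurable ?_) ‖f‖
        (ae_of_all _ fun p ↦ hbound p.2 fun i ↦ p.1 (gridIndex M (p.2 i)))
      exact ((measurable_one.indicator (measurableSet_simplexSet n)).comp measurable_snd).mul
        (f.continuous.measurable.comp (measurable_comp_gridIndex M n))
  have hb : ∀ᶠ M in atTop, ∫ t, b M t ∂m =
      ((M + 1).choose n : ℝ) / ((M : ℝ) + 1) ^ n * ∫ x, f x ∂(μ n) := by
    filter_upwards [eventually_ge_atTop n] with M hM
    have := hprob (M + 1) (by omega)
    have hc : ((M + 1).choose n : ℝ) ≠ 0 := by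
      exact_mod_cast (Nat.choose_pos (by omega)).ne'
    rw [integral_strictMono_gridIndex, ← hthin n (M + 1) hn (by omega),
      integral_thinTrans _ f.continuous.measurable f.norm_coe_le_norm]
    simp only [h, Function.comp_def]
    field_simp
  have hdiff : Tendsto (fun M ↦ ∫ t, (a M t - b M t) ∂m) atTop (𝓝 0) := by
    rw [← integral_zero (Fin n → ℝ) ℝ (μ := m)]
    refine tendsto_integral_of_dominated_convergence (fun _ ↦ ‖f‖ + ‖f‖)
      (fun M ↦ ((ha_meas M).sub (hb_meas M)).aestronglyMeasurable) (integrable_const _)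
      (fun M ↦ ae_of_all _ fun t ↦ (norm_sub_le _ _).trans
        (add_le_add (ha_bound M t) (hb_bound M t))) ?_
    filter_upwards [ae_mem_simplexSet_of_strictMono n] with t ht
    refine tendsto_const_nhds.congr' ?_
    by_cases hts : t ∈ simplexSet n
    · filter_upwards [eventually_strictMono_gridIndex hts] with M hM
      have hM' : (fun i ↦ gridIndex M (t i)) ∈ {ι : Fin n → Fin (M + 1) | StrictMono ι} := hM
      simp only [a, b, indicator_of_mem hts, indicator_of_mem hM', Pi.one_apply, one_mul, sub_self]
    · refine Eventually.of_forall fun M ↦ ?_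
      have hM' : (fun i ↦ gridIndex M (t i)) ∉ {ι : Fin n → Fin (M + 1) | StrictMono ι} :=
        fun hm ↦ hts (ht fun i j hij ↦ (monotone_gridIndex M).reflect_lt (hm hij))
      simp only [a, b, indicator_of_notMem hts, indicator_of_notMem hM', zero_mul, sub_self]
  have hlim := hdiff.add (((tendsto_choose_div_pow n).mul_const (∫ x, f x ∂(μ n))).congr'
    (hb.mono fun M hM ↦ hM.symm))
  rw [zero_add] at hlim
  refine hlim.congr fun M ↦ ?_
  rw [hswap, integral_sub (ha_int M) (hb_int M), sub_add_cancel]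

lemma continuous_stepMeasure (M : ℕ) : Continuous (stepMeasure M : (Fin (M + 1) → X) → _) := by
  refine continuous_induced_rng.2
    (ProbabilityMeasure.continuous_iff_forall_continuous_integral.2 fun f ↦ ?_)
  change Continuous fun x : Fin (M + 1) → X ↦
    ∫ e, f e ∂(unitLebesgue.map fun t ↦ (t, x (gridIndex M t)))
  have h (x : Fin (M + 1) → X) : ∫ e, f e ∂(unitLebesgue.map fun t ↦ (t, x (gridIndex M t))) =
      ∫ t, f (t, x (gridIndex M t)) ∂unitLebesgue :=
    integral_map (measurable_graph_gridIndex M x).aemeasurable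
      f.continuous.measurable.aestronglyMeasurable
  simp only [h]
  refine continuous_of_dominated (bound := fun _ ↦ ‖f‖) (fun x ↦ ?_)
    (fun x ↦ ae_of_all _ fun t ↦ f.norm_coe_le_norm _) (integrable_const _)
    (ae_of_all _ fun t ↦ by fun_prop)
  exact (f.continuous.measurable.comp (measurable_graph_gridIndex M x)).aestronglyMeasurable

lemma integral_simplexTest_stepMeasure (M : ℕ) (x : Fin (M + 1) → X) {n : ℕ}
    {f : (Fin n → X) → ℝ} (hf : Continuous f) :
    ∫ e, simplexTest f e ∂(Measure.pi fun _ ↦ ((stepMeasure M x).toProb : Measure (ℝ × X))) =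
      ∫ t, (simplexSet n).indicator 1 t * f (fun i ↦ x (gridIndex M (t i)))
        ∂(Measure.pi fun _ : Fin n ↦ unitLebesgue) := by
  have hm := measurable_graph_gridIndex M x
  have : IsProbabilityMeasure (unitLebesgue.map fun t ↦ (t, x (gridIndex M t))) :=
    Measure.isProbabilityMeasure_map hm.aemeasurable
  simp only [toMeasure_stepMeasure]
  rw [← Measure.pi_map_pi (fun _ ↦ hm.aemeasurable), integral_map]
  · rfl
  · exact (measurable_pi_lambda _ fun i ↦ hm.comp (measurable_pi_apply i)).aemeasurable
  · exact (measurable_simplexTest hf).aestronglyMeasurable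

/-- A limit point of the laws of the step measures represents every continuous functional of the
thinning-invariant sequence. -/
lemma exists_law_integral_simplexTest [CompactSpace X] (μ : (n : ℕ) → Measure (Fin n → X))
    (hprob : ∀ n, 1 ≤ n → IsProbabilityMeasure (μ n))
    (hthin : ∀ k n, 1 ≤ k → k ≤ n → thinTrans k n (μ n) = μ k) :
    ∃ Q : ProbabilityMeasure (UniformMarginal X), ∀ n, 1 ≤ n → ∀ f : (Fin n → X) →ᵇ ℝ,
      ∫ ν, ∫ e, simplexTest f e ∂(Measure.pi fun _ ↦ (ν.toProb : Measure (ℝ × X)))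
        ∂(Q : Measure (UniformMarginal X)) = (n.factorial : ℝ)⁻¹ * ∫ x, f x ∂(μ n) := by
  have hmeas : ∀ M, Measurable (stepMeasure M : (Fin (M + 1) → X) → _) := fun M ↦
    (continuous_stepMeasure M).measurable
  let Q (M : ℕ) : ProbabilityMeasure (UniformMarginal X) :=
    ⟨(μ (M + 1)).map (stepMeasure M),
      have := hprob (M + 1) (by omega)
      Measure.isProbabilityMeasure_map (hmeas M).aemeasurable⟩
  let U : Ultrafilter ℕ := Ultrafilter.of atTop
  obtain ⟨Q₀, -, hQ₀⟩ := isCompact_univ.ultrafilter_le_nhds (U.map Q) (by simp)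
  have hQ₀' : Tendsto Q (U : Filter ℕ) (𝓝 Q₀) := hQ₀
  refine ⟨Q₀, fun n hn f ↦ ?_⟩
  let F : UniformMarginal X →ᵇ ℝ :=
    mkOfCompact ⟨_, UniformMarginal.continuous_integral_simplexTest f⟩
  have h₁ := ProbabilityMeasure.tendsto_iff_forall_integral_tendsto.1 hQ₀' F
  have h₂ := (tendsto_integral_simplex_gridIndex μ hprob hthin hn f).mono_left
    (Ultrafilter.of_le (atTop : Filter ℕ))
  refine tendsto_nhds_unique h₁ (h₂.congr fun M ↦ ?_)
  change _ = ∫ ν, F ν ∂((μ (M + 1)).map (stepMeasure M))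
  rw [integral_map (hmeas M).aemeasurable F.continuous.measurable.aestronglyMeasurable]
  exact integral_congr_ae (ae_of_all _ fun x ↦
    (integral_simplexTest_stepMeasure M x f.continuous).symm)

end

section

variable {X : Type*} [TopologicalSpace X] [PolishSpace X] [MeasurableSpace X] [BorelSpace X]

lemma lintegral_simplexTest {n : ℕ} (ν : UniformMarginal X) (f : (Fin n → X) →ᵇ ℝ)
    (hf : ∀ x, 0 ≤ f x) :
    ∫⁻ e in {e | (fun i ↦ (e i).1) ∈ simplexSet n}, ENNReal.ofReal (f fun i ↦ (e i).2)
        ∂(Measure.pi fun _ ↦ (ν.toProb : Measure (ℝ × X))) =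
      ENNReal.ofReal (∫ e, simplexTest f e
        ∂(Measure.pi fun _ ↦ (ν.toProb : Measure (ℝ × X)))) := by
  have hms : MeasurableSet {e : Fin n → ℝ × X | (fun i ↦ (e i).1) ∈ simplexSet n} :=
    (by fun_prop : Measurable fun (e : Fin n → ℝ × X) i ↦ (e i).1) (measurableSet_simplexSet n)
  have heq : ∀ e : Fin n → ℝ × X, ENNReal.ofReal (simplexTest f e) =
      {e : Fin n → ℝ × X | (fun i ↦ (e i).1) ∈ simplexSet n}.indicator
        (fun e ↦ ENNReal.ofReal (f fun i ↦ (e i).2)) e := by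
    intro e
    by_cases he : (fun i ↦ (e i).1) ∈ simplexSet n <;> simp [simplexTest, he]
  have hnonneg : ∀ e, 0 ≤ simplexTest f e := fun e ↦
    mul_nonneg (indicator_nonneg (fun _ _ ↦ zero_le_one) _) (hf _)
  have hint : Integrable (simplexTest f)
      (Measure.pi fun _ ↦ (ν.toProb : Measure (ℝ × X))) := by
    refine .of_bound (measurable_simplexTest f.continuous).aestronglyMeasurable ‖f‖
      (ae_of_all _ fun e ↦ ?_)
    by_cases he : (fun i ↦ (e i).1) ∈ simplexSet n
    · simpa [simplexTest, he] using f.norm_coe_le_norm fun i ↦ (e i).2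
    · simp [simplexTest, he]
  rw [← lintegral_indicator hms, ofReal_integral_eq_lintegral_ofReal hint (ae_of_all _ hnonneg)]
  simp only [heq]

/-- A law on `UniformMarginal X` which represents a measure on continuous functions represents it
on measurable boxes. -/
lemma measure_eq_lintegral_simplexSet [CompactSpace X] {n : ℕ} (μ : Measure (Fin n → X))
    [IsFiniteMeasure μ]
    (Q : ProbabilityMeasure (UniformMarginal X))
    (hQ : ∀ f : (Fin n → X) →ᵇ ℝ,
      ∫ ν, ∫ e, simplexTest f e ∂(Measure.pi fun _ ↦ (ν.toProb : Measure (ℝ × X)))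
        ∂(Q : Measure (UniformMarginal X)) = (n.factorial : ℝ)⁻¹ * ∫ x, f x ∂μ)
    {S : Set (Fin n → X)} (hS : MeasurableSet S) :
    μ S = ∫⁻ ν, n.factorial * (Measure.pi fun _ ↦ (ν.toProb : Measure (ℝ × X)))
      {e | (fun i ↦ (e i).1) ∈ simplexSet n ∧ (fun i ↦ (e i).2) ∈ S}
        ∂(Q : Measure (UniformMarginal X)) := by
  let D : Set (Fin n → ℝ × X) := {e | (fun i ↦ (e i).1) ∈ simplexSet n}
  have hD : MeasurableSet D :=
    (by fun_prop : Measurable fun (e : Fin n → ℝ × X) i ↦ (e i).1) (measurableSet_simplexSet n)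
  have hsnd : Measurable fun (e : Fin n → ℝ × X) i ↦ (e i).2 := by fun_prop
  let m (ν : UniformMarginal X) : Measure (Fin n → X) :=
    ((Measure.pi fun _ ↦ (ν.toProb : Measure (ℝ × X))).restrict D).map fun e i ↦ (e i).2
  have hpi : Measurable fun ν : UniformMarginal X ↦
      Measure.pi fun _ : Fin n ↦ (ν.toProb : Measure (ℝ × X)) :=
    (ProbabilityMeasure.continuous_pi.comp (_root_.continuous_pi fun _ : Fin n ↦
      UniformMarginal.continuous_toProb)).measurable_toMeasure
  have hm : Measurable m := by
    refine (Measure.measurable_map _ hsnd).comp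
      (Measure.measurable_of_measurable_coe _ fun s hs ↦ ?_)
    simp only [Measure.restrict_apply hs]
    exact (Measure.measurable_coe (hs.inter hD)).comp hpi
  have hfac : (n.factorial : ℝ) ≠ 0 := by positivity
  have key : μ = (n.factorial : ℝ≥0∞) • (Q : Measure (UniformMarginal X)).bind m := by
    refine ext_of_forall_lintegral_eq_of_IsFiniteMeasure fun f ↦ ?_
    let g : (Fin n → X) →ᵇ ℝ :=
      ⟨⟨fun x ↦ (f x : ℝ), NNReal.continuous_coe.comp f.continuous⟩, f.map_bounded'⟩
    have hg : ∀ x, 0 ≤ g x := fun x ↦ (f x).2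
    have hfg : ∀ x, (f x : ℝ≥0∞) = ENNReal.ofReal (g x) := fun x ↦
      (ENNReal.ofReal_coe_nnreal (p := f x)).symm
    let F : UniformMarginal X →ᵇ ℝ :=
      mkOfCompact ⟨_, UniformMarginal.continuous_integral_simplexTest g⟩
    have hF : ∀ ν, ∫⁻ x, ENNReal.ofReal (g x) ∂(m ν) = ENNReal.ofReal (F ν) := fun ν ↦ by
      rw [lintegral_map g.continuous.measurable.ennreal_ofReal hsnd]
      exact lintegral_simplexTest ν g hg
    have hF_nonneg : ∀ ν, 0 ≤ F ν := fun ν ↦ integral_nonneg fun e ↦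
      mul_nonneg (indicator_nonneg (fun _ _ ↦ zero_le_one) _) (hg _)
    have hQg : ∫ ν, F ν ∂(Q : Measure (UniformMarginal X)) =
      (n.factorial : ℝ)⁻¹ * ∫ x, g x ∂μ := hQ g
    simp only [hfg]
    rw [lintegral_smul_measure, Measure.lintegral_bind hm.aemeasurable
      g.continuous.measurable.ennreal_ofReal.aemeasurable]
    simp only [hF]
    rw [← ofReal_integral_eq_lintegral_ofReal (F.integrable _) (ae_of_all _ hF_nonneg), hQg,
      ← ofReal_integral_eq_lintegral_ofReal (g.integrable _) (ae_of_all _ hg), smul_eq_mul,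
      ← ENNReal.ofReal_natCast, ← ENNReal.ofReal_mul (by positivity), mul_inv_cancel_left₀ hfac]
  conv_lhs => rw [key]
  rw [Measure.smul_apply, Measure.bind_apply hS hm.aemeasurable, smul_eq_mul, lintegral_const_mul']
  · congr 1
    refine lintegral_congr fun ν ↦ ?_
    rw [Measure.map_apply hsnd hS, Measure.restrict_apply (hsnd hS), inter_comm]
    rfl
  · simp

end

lemma lintegral_pi_prod {n : ℕ} {Ω : Type*} [MeasurableSpace Ω] (m : Measure Ω)
    [IsProbabilityMeasure m] {g : Fin n → Ω → ℝ≥0∞} (hg : ∀ i, Measurable (g i)) :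
    ∫⁻ t, ∏ i, g i (t i) ∂(Measure.pi fun _ ↦ m) = ∏ i, ∫⁻ s, g i s ∂m := by
  refine (lintegral_prod_eq_prod_lintegral_of_indepFun Finset.univ
    (fun i (t : Fin n → Ω) ↦ g i (t i)) (iIndepFun_pi fun i ↦ (hg i).aemeasurable)
    (fun i ↦ (hg i).comp (measurable_pi_apply i))).trans ?_
  refine Finset.prod_congr rfl fun i _ ↦ ?_
  exact (measurePreserving_eval (fun _ : Fin n ↦ m) i).lintegral_comp (hg i)

/-- The product of copies of a disintegrated measure, evaluated on the points whose first
coordinates lie in the simplex and whose second coordinates lie in a box. -/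
lemma pi_simplexSet_eq_lintegral {X : Type*} [MeasurableSpace X] {ν : Measure (ℝ × X)}
    [IsProbabilityMeasure ν] {κ : ℝ → Measure X} [∀ t, IsProbabilityMeasure (κ t)]
    (hκ : ∀ B, MeasurableSet B → Measurable fun t ↦ κ t B)
    (hν : ∀ E B, MeasurableSet E → MeasurableSet B →
      ν (E ×ˢ B) = ∫⁻ t in E, κ t B ∂unitLebesgue)
    {n : ℕ} {A : Fin n → Set X} (hA : ∀ i, MeasurableSet (A i)) :
    (Measure.pi fun _ ↦ ν)
        {e | (fun i ↦ (e i).1) ∈ simplexSet n ∧ (fun i ↦ (e i).2) ∈ univ.pi A} =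
      ∫⁻ t in simplexSet n, ∏ i, κ (t i) (A i) := by
  have hfst : Measurable fun (e : Fin n → ℝ × X) i ↦ (e i).1 := by fun_prop
  have hsnd : Measurable fun (e : Fin n → ℝ × X) i ↦ (e i).2 := by fun_prop
  have hpiA : MeasurableSet (univ.pi A) := .univ_pi hA
  let m : Measure (Fin n → ℝ) :=
    ((Measure.pi fun _ ↦ ν).restrict ((fun e i ↦ (e i).2) ⁻¹' univ.pi A)).map fun e i ↦ (e i).1
  let w (i : Fin n) : Measure ℝ := unitLebesgue.withDensity fun t ↦ κ t (A i)
  have hw : ∀ i, IsFiniteMeasure (w i) := fun i ↦ isFiniteMeasure_withDensity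
    ((lintegral_mono fun t ↦ prob_le_one).trans_lt (by simp)).ne
  have h₁ : Measure.pi w = m := by
    refine Measure.pi_eq fun s hs ↦ ?_
    have hset : (fun (e : Fin n → ℝ × X) i ↦ (e i).1) ⁻¹' univ.pi s ∩
        (fun e i ↦ (e i).2) ⁻¹' univ.pi A = univ.pi fun i ↦ s i ×ˢ A i := by
      ext e
      simp [forall_and]
    rw [Measure.map_apply hfst (.univ_pi hs), Measure.restrict_apply (hfst (.univ_pi hs)), hset,
      Measure.pi_pi]
    refine Finset.prod_congr rfl fun i _ ↦ ?_
    rw [hν _ _ (hs i) (hA i), withDensity_apply _ (hs i)]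
  have h₂ : Measure.pi w =
      (Measure.pi fun _ ↦ unitLebesgue).withDensity fun t ↦ ∏ i, κ (t i) (A i) := by
    refine Measure.pi_eq fun s hs ↦ ?_
    rw [withDensity_apply _ (.univ_pi hs), ← lintegral_indicator (.univ_pi hs)]
    have hind : ∀ t, (univ.pi s).indicator (fun t ↦ ∏ i, κ (t i) (A i)) t =
        ∏ i, (s i).indicator (fun r ↦ κ r (A i)) (t i) := by
      intro t
      by_cases ht : t ∈ univ.pi s
      · rw [indicator_of_mem ht]
        exact Finset.prod_congr rfl fun i _ ↦ 
          (indicator_of_mem (ht i (mem_univ i)) fun r ↦ κ r (A i)).symm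
      · rw [indicator_of_notMem ht]
        obtain ⟨i, hi⟩ : ∃ i, t i ∉ s i := by simpa [Set.mem_pi] using ht
        exact (Finset.prod_eq_zero (Finset.mem_univ i) (indicator_of_notMem hi _)).symm
    simp only [hind]
    rw [lintegral_pi_prod _ fun i ↦ (hκ _ (hA i)).indicator (hs i)]
    refine Finset.prod_congr rfl fun i _ ↦ ?_
    rw [lintegral_indicator (hs i), withDensity_apply _ (hs i)]
  have hsimplex : simplexSet n ⊆ univ.pi fun _ ↦ Icc (0 : ℝ) 1 := fun t ht i _ ↦
    Ioo_subset_Icc_self (ht.2 i)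
  calc _ = m (simplexSet n) := by
        rw [Measure.map_apply hfst (measurableSet_simplexSet n),
          Measure.restrict_apply (hfst (measurableSet_simplexSet n))]
        rfl
    _ = _ := by
        rw [← h₁, h₂, withDensity_apply _ (measurableSet_simplexSet n), ← Measure.restrict_pi_pi,
          Measure.restrict_restrict (measurableSet_simplexSet n), inter_eq_left.2 hsimplex]
        rfl

lemma measurableSet_Kset (X : Type*) [MeasurableSpace X] : MeasurableSet (Kset X) := by
  have h : Kset X = {ν | ν univ = 1} ∩
      ⋂ q : ℚ, {ν : Measure (ℝ × X) | ν (Prod.fst ⁻¹' Iic (q : ℝ)) = unitLebesgue (Iic (q : ℝ))} := by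
    ext ν
    simp only [Kset, mem_inter_iff, mem_iInter]
    constructor
    · rintro ⟨hν, h⟩
      refine ⟨hν.measure_univ, fun q ↦ ?_⟩
      change ν (Prod.fst ⁻¹' Iic (q : ℝ)) = unitLebesgue (Iic (q : ℝ))
      rw [← Measure.fst_apply measurableSet_Iic, h]
    · rintro ⟨hν, h⟩
      have hν' : IsProbabilityMeasure ν := ⟨hν⟩
      refine ⟨hν', ?_⟩
      refine ext_of_generate_finite _
        ((BorelSpace.measurable_eq (α := ℝ)).trans Real.borel_eq_generateFrom_Iic_rat)
        Real.isPiSystem_Iic_rat (fun s hs ↦ ?_) (by simp)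
      obtain ⟨q, rfl⟩ := by simpa using hs
      rw [Measure.fst_apply measurableSet_Iic]
      exact h q
  rw [h]
  refine MeasurableSet.inter (Measure.measurable_coe .univ (measurableSet_singleton 1))
    (.iInter fun q ↦ ?_)
  exact Measure.measurable_coe (measurable_fst measurableSet_Iic) (measurableSet_singleton _)

/-- The conditional kernel of a finite measure on `ℝ × X`, extended by zero to all measures. -/
noncomputable def fiberMeasure {X : Type*} [MeasurableSpace X] [StandardBorelSpace X] [Nonempty X]
    (ν : Measure (ℝ × X)) (t : ℝ) : Measure X := by
  classical exact if h : IsFiniteMeasure ν then ν.condKernel t else 0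

section

variable {X : Type*} [MeasurableSpace X] [StandardBorelSpace X] [Nonempty X]

lemma fiberMeasure_eq (ν : Measure (ℝ × X)) [h : IsFiniteMeasure ν] :
    fiberMeasure ν = ν.condKernel := by
  ext1 t
  exact dif_pos h

lemma measure_prod_eq_setLIntegral_fiberMeasure {ν : Measure (ℝ × X)} (hν : ν ∈ Kset X)
    {E : Set ℝ} {B : Set X} (hE : MeasurableSet E) (hB : MeasurableSet B) :
    ν (E ×ˢ B) = ∫⁻ t in E, fiberMeasure ν t B ∂unitLebesgue := by
  have := hν.1
  rw [fiberMeasure_eq, unitLebesgue, ← hν.2, ← Measure.compProd_apply_prod hE hB,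
    Measure.disintegrate]

/-- Evaluating the `n`-fold power of a probability measure on a measurable set is measurable in
the measure. -/
lemma exists_measurable_pi {Ω : Type*} [MeasurableSpace Ω] [Nonempty Ω] {n : ℕ}
    {S : Set (Fin n → Ω)} (hS : MeasurableSet S) :
    ∃ H : Measure Ω → ℝ≥0∞, Measurable H ∧
      ∀ ν, IsProbabilityMeasure ν → H ν = (Measure.pi fun _ ↦ ν) S := by
  classical
  let x₀ : Ω := Classical.arbitrary Ω
  let T (ν : Measure Ω) : Measure Ω := if ν univ = 1 then ν else Measure.dirac x₀
  have hT_prob : ∀ ν, IsProbabilityMeasure (T ν) := by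
    intro ν
    by_cases h : ν univ = 1
    · simp only [T, if_pos h]; exact ⟨h⟩
    · simp only [T, if_neg h]; infer_instance
  have hT : Measurable T := Measurable.ite
    (Measure.measurable_coe .univ (measurableSet_singleton 1)) measurable_id measurable_const
  have hpi : Measurable fun ν ↦ Measure.pi fun _ : Fin n ↦ T ν := by
    refine Measurable.measure_of_isPiSystem_of_isProbabilityMeasure generateFrom_pi.symm
      isPiSystem_pi ?_
    rintro _ ⟨B, hB, rfl⟩
    simp only [Measure.pi_pi]
    exact Finset.measurable_prod _ fun i _ ↦ (Measure.measurable_coe (hB i (mem_univ i))).comp hT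
  refine ⟨_, (Measure.measurable_coe hS).comp hpi, fun ν hν ↦ ?_⟩
  simp only [Function.comp_apply, T, if_pos hν.measure_univ]

end

/-- **Representation theorem for thinning-invariant triangular arrays.**
If `(μ_n)` is a thinning-invariant sequence of Borel probability measures, `μ_n` on `𝒳ⁿ`,
then there is a Borel probability measure `P` on measures on `[0,1] × 𝒳`, concentrated on
the set `𝒦` of measures with Lebesgue first marginal, together with a disintegration
`κ ν` of each `ν ∈ 𝒦` over its Lebesgue first marginal, such that
`μ_n(A₁×⋯×A_n) = ∫_𝒦 n! ∫_{Δⁿ} ∏ᵢ (κ ν)_{tᵢ}(Aᵢ) dt dP(ν)`. -/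
theorem thinning_invariant_representation
    {X : Type*} [MetricSpace X] [CompactSpace X] [MeasurableSpace X] [BorelSpace X]
    (μ : (n : ℕ) → Measure (Fin n → X))
    (hprob : ∀ n, 1 ≤ n → IsProbabilityMeasure (μ n))
    (hthin : ∀ k n, 1 ≤ k → k ≤ n → thinTrans k n (μ n) = μ k) :
    ∃ (P : Measure (Measure (ℝ × X))) (κ : Measure (ℝ × X) → ℝ → Measure X),
      IsProbabilityMeasure P ∧
      P (Kset X)ᶜ = 0 ∧
      (∀ ν ∈ Kset X,
        (∀ t, IsProbabilityMeasure (κ ν t)) ∧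
        (∀ B : Set X, MeasurableSet B → Measurable fun t => κ ν t B) ∧
        (∀ (E : Set ℝ) (B : Set X), MeasurableSet E → MeasurableSet B →
          ν (E ×ˢ B) = ∫⁻ t in E, κ ν t B ∂(volume.restrict (Set.Icc (0 : ℝ) 1)))) ∧
      (∀ n, 1 ≤ n → ∀ A : Fin n → Set X, (∀ i, MeasurableSet (A i)) →
        μ n (Set.univ.pi A) =
          ∫⁻ ν in Kset X,
            (Nat.factorial n : ℝ≥0∞) *
              ∫⁻ t in simplexSet n, ∏ i, κ ν (t i) (A i) ∂volume ∂P) := by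
  have hX : Nonempty X := by
    have := hprob 1 le_rfl
    exact (nonempty_of_isProbabilityMeasure (μ 1)).map fun x ↦ x 0
  obtain ⟨Q, hQ⟩ := exists_law_integral_simplexTest μ hprob hthin
  have hG : Measurable fun ν : UniformMarginal X ↦ (ν.toProb : Measure (ℝ × X)) :=
    UniformMarginal.continuous_toProb.measurable_toMeasure
  have hGK : ∀ ν : UniformMarginal X, (ν.toProb : Measure (ℝ × X)) ∈ Kset X := fun ν ↦
    ⟨inferInstance, ν.fst_toProb⟩
  have hprobκ : ∀ ν ∈ Kset X, ∀ t, IsProbabilityMeasure (fiberMeasure ν t) := by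
    intro ν hν t
    have := hν.1
    rw [fiberMeasure_eq]
    infer_instance
  have hmeasκ : ∀ ν ∈ Kset X, ∀ B : Set X, MeasurableSet B →
      Measurable fun t ↦ fiberMeasure ν t B := by
    intro ν hν B hB
    have := hν.1
    rw [fiberMeasure_eq]
    exact Kernel.measurable_coe _ hB
  refine ⟨(Q : Measure (UniformMarginal X)).map fun ν ↦ (ν.toProb : Measure (ℝ × X)),
    fiberMeasure, Measure.isProbabilityMeasure_map hG.aemeasurable, ?_,
    fun ν hν ↦ ⟨hprobκ ν hν, hmeasκ ν hν, fun E B ↦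
      measure_prod_eq_setLIntegral_fiberMeasure hν⟩, fun n hn A hA ↦ ?_⟩
  · rw [Measure.map_apply hG (measurableSet_Kset X).compl, preimage_compl,
      preimage_eq_univ_iff.2 (range_subset_iff.2 hGK), compl_univ, measure_empty]
  · have := hprob n hn
    have hS : MeasurableSet {e : Fin n → ℝ × X |
        (fun i ↦ (e i).1) ∈ simplexSet n ∧ (fun i ↦ (e i).2) ∈ univ.pi A} :=
      ((by fun_prop : Measurable fun (e : Fin n → ℝ × X) i ↦ (e i).1)
        (measurableSet_simplexSet n)).inter
        ((by fun_prop : Measurable fun (e : Fin n → ℝ × X) i ↦ (e i).2) (.univ_pi hA))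
    obtain ⟨H, hH, hHpi⟩ := exists_measurable_pi hS
    rw [measure_eq_lintegral_simplexSet (μ n) Q (hQ n hn) (.univ_pi hA)]
    calc _ = ∫⁻ ν, n.factorial * H ν ∂((Q : Measure (UniformMarginal X)).map fun ν ↦
            (ν.toProb : Measure (ℝ × X))) := by
          rw [lintegral_map (hH.const_mul _) hG]
          exact lintegral_congr fun ν ↦ by rw [hHpi _ inferInstance]
      _ = ∫⁻ ν in Kset X, n.factorial * H ν ∂((Q : Measure (UniformMarginal X)).map fun ν ↦
            (ν.toProb : Measure (ℝ × X))) := by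
          rw [Measure.restrict_eq_self_of_ae_mem]
          exact (ae_map_iff hG.aemeasurable (measurableSet_Kset X)).2 (ae_of_all _ hGK)
      _ = _ := by
          refine setLIntegral_congr_fun (measurableSet_Kset X) fun ν hν ↦ ?_
          have := hν.1
          have := hprobκ ν hν
          simp only [hHpi ν hν.1]
          rw [pi_simplexSet_eq_lintegral (hmeasκ ν hν)
            (fun _ _ ↦ measure_prod_eq_setLIntegral_fiberMeasure hν) hA]
end

section
/- Let 𝒳 be a compact metric space and let (μ_n)_{n≥1} be a thinning-invariant sequence of Borel probability measures, μ_n on 𝒳^n. If P₁ and P₂ are Borel probability measures on M₁([0,1]×𝒳) (weak topology), each concentrated on the set 𝒦 of measures whose first marginal is Lebesgue measure, and each satisfying μ_n(A₁×⋯×A_n) = ∫_𝒦 [ n! ∫_{Δⁿ} ∏_{i=1}^n ν_{t_i}(A_i) dt₁⋯dt_n ] P_j(dν) for all n ≥ 1 and all Borel A₁,…,A_n ⊆ 𝒳 (where (ν_t) is a disintegration of ν over Lebesgue measure and Δⁿ = {0 < t₁ < ⋯ < t_n < 1}), then P₁ = P₂. -/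
open MeasureTheory
open scoped ENNReal

/-- `κ` assigns to each `ν ∈ 𝒦` a disintegration of `ν` over its Lebesgue first marginal:
a Borel family of probability measures `(κ ν t)_t` with `ν(dt ⊗ dx) = dt (κ ν t)(dx)`. -/
def IsDisintegration {X : Type*} [MeasurableSpace X]
    (κ : Measure (ℝ × X) → ℝ → Measure X) : Prop :=
  ∀ ν ∈ Kset X,
    (∀ t, IsProbabilityMeasure (κ ν t)) ∧
    (∀ B : Set X, MeasurableSet B → Measurable fun t => κ ν t B) ∧
    (∀ (E : Set ℝ) (B : Set X), MeasurableSet E → MeasurableSet B →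
      ν (E ×ˢ B) = ∫⁻ t in E, κ ν t B ∂(volume.restrict (Set.Icc (0 : ℝ) 1)))

open scoped BoundedContinuousFunction in
/-- Two finite measures on a cube that integrate all monomials equally coincide. -/
theorem ext_of_lintegral_monomial_unitInterval {ι : Type*} [Countable ι]
    (μ ν : Measure (ι → unitInterval)) [IsFiniteMeasure μ] [IsFiniteMeasure ν]
    (h : ∀ (n : ℕ) (r : Fin n → ι),
      ∫⁻ x, ∏ l, ENNReal.ofReal (x (r l)) ∂μ = ∫⁻ x, ∏ l, ENNReal.ofReal (x (r l)) ∂ν) :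
    μ = ν := by
  let c : ι → ((ι → unitInterval) →ᵇ ℝ) := fun i =>
    BoundedContinuousFunction.mkOfCompact ⟨fun x => (x i : ℝ), by fun_prop⟩
  let A : StarSubalgebra ℝ ((ι → unitInterval) →ᵇ ℝ) :=
    { Algebra.adjoin ℝ (Set.range c) with
      star_mem' := fun {a} ha => by
        have e : star a = a := by
          ext x
          exact star_trivial (a x)
        exact e.symm ▸ ha }
  have hmono : ∀ l : List ι, ∀ x, ((l.map c).prod) x = ∏ j : Fin l.length, (x (l.get j) : ℝ) := by
    intro l x
    induction l with
    | nil => simp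
    | cons a l ih =>
      simp only [List.map_cons, List.prod_cons, BoundedContinuousFunction.mul_apply, ih]
      exact (Fin.prod_univ_succ (fun j : Fin (l.length + 1) => (x ((a :: l).get j) : ℝ))).symm
  refine ext_of_forall_mem_subalgebra_integral_eq_of_polish (𝕜 := ℝ) (A := A) ?_ ?_
  · intro x y hxy
    obtain ⟨i, hi⟩ := Function.ne_iff.mp hxy
    refine ⟨c i, ⟨_, ⟨c i, Algebra.subset_adjoin ⟨i, rfl⟩, rfl⟩, rfl⟩, ?_⟩
    simpa [c, Subtype.ext_iff] using hi
  · intro g hg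
    have hg' : g ∈ Submodule.span ℝ
        (Submonoid.closure (Set.range c) : Set ((ι → unitInterval) →ᵇ ℝ)) := by
      rw [← Algebra.adjoin_eq_span]
      exact hg
    induction hg' using Submodule.span_induction with
    | zero => simp
    | add a b ha hb iha ihb =>
      rw [← Algebra.adjoin_eq_span] at ha hb
      have e : ∀ x, (a + b) x = a x + b x := fun x => rfl
      simp only [e]
      rw [integral_add (a.integrable _) (b.integrable _),
        integral_add (a.integrable _) (b.integrable _), iha ha, ihb hb]
    | smul r a ha iha =>
      rw [← Algebra.adjoin_eq_span] at ha
      have e : ∀ x, (r • a) x = r * a x := fun x => rfl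
      simp only [e]
      rw [integral_const_mul, integral_const_mul, iha ha]
    | mem g hg2 =>
      obtain ⟨l, hl, rfl⟩ := Submonoid.exists_list_of_mem_closure hg2
      obtain ⟨l, rfl⟩ : ∃ l' : List ι, l'.map c = l := by
        rwa [← Set.mem_range, Set.range_list_map]
      have key : ∀ (ρ : Measure (ι → unitInterval)), ∫ x, ((l.map c).prod) x ∂ρ =
          (∫⁻ x, ∏ j : Fin l.length, ENNReal.ofReal (x (l.get j)) ∂ρ).toReal := by
        intro ρ
        rw [integral_eq_lintegral_of_nonneg_ae]
        · congr 2
          ext x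
          rw [hmono, ENNReal.ofReal_prod_of_nonneg]
          exact fun i _ => (x _).2.1
        · refine Filter.Eventually.of_forall fun x => ?_
          simp only [hmono, Pi.zero_apply]
          exact Finset.prod_nonneg fun i _ => (x _).2.1
        · exact (BoundedContinuousFunction.continuous _).aestronglyMeasurable
      rw [key, key, h]

/-- Two finite measures on `ι → ℝ` concentrated on the unit cube that integrate all monomials
equally coincide. -/
theorem ext_of_lintegral_monomial {ι : Type*} [Countable ι]
    (μ ν : Measure (ι → ℝ)) [IsFiniteMeasure μ] [IsFiniteMeasure ν]
    (hμ : ∀ᵐ x ∂μ, ∀ i, x i ∈ Set.Icc (0 : ℝ) 1) (hν : ∀ᵐ x ∂ν, ∀ i, x i ∈ Set.Icc (0 : ℝ) 1)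
    (h : ∀ (n : ℕ) (r : Fin n → ι),
      ∫⁻ x, ∏ l, ENNReal.ofReal (x (r l)) ∂μ = ∫⁻ x, ∏ l, ENNReal.ofReal (x (r l)) ∂ν) :
    μ = ν := by
  let p : (ι → ℝ) → ι → unitInterval := fun x i => Set.projIcc 0 1 zero_le_one (x i)
  let q : (ι → unitInterval) → ι → ℝ := fun x i => x i
  have hp : Measurable p :=
    measurable_pi_lambda _ fun i => continuous_projIcc.measurable.comp (measurable_pi_apply i)
  have hq : Measurable q :=
    measurable_pi_lambda _ fun i => measurable_subtype_coe.comp (measurable_pi_apply i)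
  have hqp : ∀ x : ι → ℝ, (∀ i, x i ∈ Set.Icc (0 : ℝ) 1) → q (p x) = x := by
    intro x hx
    ext i
    simp only [q, p, Set.projIcc_of_mem _ (hx i)]
  have back : ∀ ρ : Measure (ι → ℝ), (∀ᵐ x ∂ρ, ∀ i, x i ∈ Set.Icc (0 : ℝ) 1) →
      (ρ.map p).map q = ρ := by
    intro ρ hρ
    rw [Measure.map_map hq hp]
    conv_rhs => rw [← Measure.map_id (μ := ρ)]
    exact Measure.map_congr (hρ.mono fun x hx => hqp x hx)
  have int : ∀ ρ : Measure (ι → ℝ), (∀ᵐ x ∂ρ, ∀ i, x i ∈ Set.Icc (0 : ℝ) 1) →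
      ∀ (n : ℕ) (r : Fin n → ι), ∫⁻ x, ∏ l, ENNReal.ofReal (x (r l)) ∂(ρ.map p) =
        ∫⁻ x, ∏ l, ENNReal.ofReal (x (r l)) ∂ρ := by
    intro ρ hρ n r
    rw [lintegral_map (by fun_prop) hp]
    refine lintegral_congr_ae (hρ.mono fun x hx => ?_)
    refine Finset.prod_congr rfl fun l _ => ?_
    exact congrArg ENNReal.ofReal (congrFun (hqp x hx) (r l))
  rw [← back μ hμ, ← back ν hν]
  congr 1
  refine ext_of_lintegral_monomial_unitInterval _ _ fun n r => ?_
  rw [int μ hμ, int ν hν, h]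

theorem pi_withDensity {ι : Type*} [Fintype ι] {Y : Type*} [MeasurableSpace Y]
    (ρ : Measure Y) [IsProbabilityMeasure ρ] (f : ι → Y → ℝ≥0∞) (hf : ∀ i, Measurable (f i))
    [∀ i, SigmaFinite (ρ.withDensity (f i))] :
    Measure.pi (fun i => ρ.withDensity (f i)) =
      (Measure.pi fun _ => ρ).withDensity fun y => ∏ i, f i (y i) := by
  refine Measure.pi_eq fun s hs => ?_
  rw [withDensity_apply _ (MeasurableSet.univ_pi hs),
    ← lintegral_indicator (MeasurableSet.univ_pi hs)]
  have e : ∀ y : ι → Y, (Set.univ.pi s).indicator (fun y => ∏ i, f i (y i)) y =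
      ∏ i, (s i).indicator (f i) (y i) := by
    intro y
    by_cases hy : y ∈ Set.univ.pi s
    · rw [Set.indicator_of_mem hy]
      exact Finset.prod_congr rfl fun i _ => (Set.indicator_of_mem (hy i trivial) _).symm
    · rw [Set.indicator_of_notMem hy]
      simp only [Set.mem_univ_pi, not_forall] at hy
      obtain ⟨i, hi⟩ := hy
      exact (Finset.prod_eq_zero (Finset.mem_univ i) (Set.indicator_of_notMem hi _)).symm
  have hg : ∀ i, Measurable ((s i).indicator (f i)) := fun i => (hf i).indicator (hs i)
  rw [lintegral_congr e, ProbabilityTheory.lintegral_prod_eq_prod_lintegral_of_indepFun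
    Finset.univ (fun i (y : ι → Y) => (s i).indicator (f i) (y i))
    (ProbabilityTheory.iIndepFun_pi fun i => (hg i).aemeasurable)
    fun i => (hg i).comp (measurable_pi_apply i)]
  refine Finset.prod_congr rfl fun i _ => ?_
  rw [(measurePreserving_eval (fun _ : ι => ρ) i).lintegral_comp (hg i),
    lintegral_indicator (hs i), withDensity_apply _ (hs i)]

theorem measurableSet_setOf_strictMono {n : ℕ} : MeasurableSet {t : Fin n → ℝ | StrictMono t} := by
  have e : {t : Fin n → ℝ | StrictMono t} = ⋂ (i) (j) (_ : i < j), {t | t i < t j} := by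
    ext t
    simp [StrictMono]
  rw [e]
  refine MeasurableSet.iInter fun i => MeasurableSet.iInter fun j => MeasurableSet.iInter fun _ => ?_
  exact measurableSet_lt (measurable_pi_apply i) (measurable_pi_apply j)

section Pointwise

variable {X : Type*} [MeasurableSpace X] {ν : Measure (ℝ × X)}

theorem measurable_fst_comp {ι : Type*} :
    Measurable fun (z : ι → ℝ × X) i => (z i).1 :=
  measurable_pi_lambda _ fun i => (measurable_pi_apply i).fst

theorem measurableSet_snd_mem {ι : Type*} [Countable ι] {A : ι → Set X}
    (hA : ∀ i, MeasurableSet (A i)) : MeasurableSet {z : ι → ℝ × X | ∀ i, (z i).2 ∈ A i} := by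
  rw [Set.ofPred_forall]
  exact MeasurableSet.iInter fun i => (measurable_pi_apply i).snd (hA i)

/-- The simplex integral of a disintegration is the probability that an i.i.d. sample is sorted
by its time coordinates and has its space coordinates in the given sets. -/
theorem lintegral_simplexSet_eq {κ : Measure (ℝ × X) → ℝ → Measure X} (hκ : IsDisintegration κ)
    (hν : ν ∈ Kset X) {n : ℕ} {A : Fin n → Set X} (hA : ∀ i, MeasurableSet (A i)) :
    ∫⁻ t in simplexSet n, ∏ i, κ ν (t i) (A i) ∂volume =
      Measure.pi (fun _ : Fin n => ν)
        {z | StrictMono (fun i => (z i).1) ∧ ∀ i, (z i).2 ∈ A i} := by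
  obtain ⟨hprob, hmeas, hdis⟩ := hκ ν hν
  have := hν.1
  set lam : Measure ℝ := volume.restrict (Set.Icc (0 : ℝ) 1) with hlam
  have : IsProbabilityMeasure lam := ⟨by simp [hlam]⟩
  have hρ : ∀ i, (ν.restrict (Set.univ ×ˢ A i)).map Prod.fst =
      lam.withDensity fun t => κ ν t (A i) := by
    intro i
    ext E hE
    rw [Measure.map_apply measurable_fst hE, Measure.restrict_apply (measurable_fst hE),
      withDensity_apply _ hE, ← hdis E (A i) hE (hA i)]
    congr 1
    ext z
    simp
  have : ∀ i, SigmaFinite (lam.withDensity fun t => κ ν t (A i)) := fun i => by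
    rw [← hρ]
    infer_instance
  have hmap : (Measure.pi fun i => ν.restrict (Set.univ ×ˢ A i)).map (fun z i => (z i).1) =
      Measure.pi fun i => lam.withDensity fun t => κ ν t (A i) := by
    simp_rw [← hρ]
    exact Measure.pi_map_pi (hμ := fun i => inferInstance) fun i => measurable_fst.aemeasurable
  have hbox : {z : Fin n → ℝ × X | ∀ i, (z i).2 ∈ A i} =
      Set.univ.pi fun i => (Set.univ ×ˢ A i) := by
    ext z
    simp
  have hset : {z : Fin n → ℝ × X | StrictMono (fun i => (z i).1) ∧ ∀ i, (z i).2 ∈ A i} =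
      (fun (z : Fin n → ℝ × X) i => (z i).1) ⁻¹' {t | StrictMono t} ∩
        {z | ∀ i, (z i).2 ∈ A i} := rfl
  have hIoo : lam = volume.restrict (Set.Ioo (0 : ℝ) 1) :=
    (Measure.restrict_congr_set Ioo_ae_eq_Icc).symm
  rw [hset, hbox, ← Measure.restrict_apply (measurable_fst_comp measurableSet_setOf_strictMono),
    Measure.restrict_pi_pi, ← Measure.map_apply measurable_fst_comp measurableSet_setOf_strictMono,
    hmap, pi_withDensity lam _ (fun i => hmeas _ (hA i)),
    withDensity_apply _ measurableSet_setOf_strictMono, hIoo, ← Measure.restrict_pi_pi,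
    Measure.restrict_restrict measurableSet_setOf_strictMono, ← volume_pi]
  congr 2
  ext t
  simp [simplexSet]

theorem pi_setOf_strictMono_reindex [IsProbabilityMeasure ν] {ι : Type*} [Fintype ι] {n : ℕ}
    (e : Fin n ≃ ι) (A : ι → Set X) :
    Measure.pi (fun _ : ι => ν) {z | StrictMono (fun i => (z (e i)).1) ∧ ∀ i, (z i).2 ∈ A i} =
      Measure.pi (fun _ : Fin n => ν)
        {z | StrictMono (fun i => (z i).1) ∧ ∀ i, (z i).2 ∈ A (e i)} := by
  rw [← (measurePreserving_piCongrLeft (fun _ : ι => ν) e).measure_preimage_equiv]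
  congr 1
  ext z
  have h : ∀ j, MeasurableEquiv.piCongrLeft (fun _ : ι => ℝ × X) e z (e j) = z j := fun j =>
    Equiv.piCongrLeft_apply_apply (fun _ : ι => ℝ × X) e z j
  simp only [Set.mem_preimage, Set.mem_ofPred_eq, h, ← e.forall_congr_right (q := fun i =>
    (MeasurableEquiv.piCongrLeft (fun _ : ι => ℝ × X) e z i).2 ∈ A i)]

theorem volume_setOf_eq_eq_zero {ι : Type*} [Fintype ι] {i j : ι} (hij : i ≠ j) :
    volume {t : ι → ℝ | t i = t j} = 0 := by
  classical
  let f : (ι → ℝ) →ₗ[ℝ] ℝ :=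
    LinearMap.proj (R := ℝ) (φ := fun _ => ℝ) i - LinearMap.proj (R := ℝ) (φ := fun _ => ℝ) j
  have e : {t : ι → ℝ | t i = t j} = (LinearMap.ker f : Set (ι → ℝ)) := by
    ext t
    simp [f, sub_eq_zero]
  rw [e]
  refine Measure.addHaar_submodule _ _ fun h => ?_
  have : Pi.single i (1 : ℝ) ∈ LinearMap.ker f := h ▸ Submodule.mem_top
  simp [f, hij.symm] at this

theorem ae_injective_fst (hν : ν ∈ Kset X) {ι : Type*} [Fintype ι] :
    ∀ᵐ z ∂Measure.pi (fun _ : ι => ν), Function.Injective fun i => (z i).1 := by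
  have := hν.1
  have hmap : (Measure.pi fun _ : ι => ν).map (fun z i => (z i).1) =
      volume.restrict (Set.univ.pi fun _ => Set.Icc (0 : ℝ) 1) := by
    rw [Measure.pi_map_pi fun i => measurable_fst.aemeasurable, volume_pi,
      Measure.restrict_pi_pi]
    exact congrArg Measure.pi (funext fun _ => hν.2)
  have h : ∀ᵐ t ∂(Measure.pi fun _ : ι => ν).map (fun z i => (z i).1),
      ∀ i j : ι, i ≠ j → t i ≠ t j := by
    rw [hmap]
    refine ae_restrict_of_ae ?_
    refine ae_all_iff.2 fun i => ae_all_iff.2 fun j => ae_all_iff.2 fun hij => ?_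
    rw [ae_iff]
    simpa using volume_setOf_eq_eq_zero hij
  filter_upwards [ae_of_ae_map measurable_fst_comp.aemeasurable h] with z hz i j hij
  by_contra hne
  exact hz i j hne hij

theorem exists_strictMono_comp_equiv {ι : Type*} [Fintype ι] {t : ι → ℝ}
    (ht : Function.Injective t) :
    ∃ e : Fin (Fintype.card ι) ≃ ι, StrictMono fun i => t (e i) := by
  let : LinearOrder ι := LinearOrder.lift' t ht
  let e := Fintype.orderIsoFinOfCardEq ι rfl
  exact ⟨e.toEquiv, fun i j hij => e.strictMono hij⟩

theorem equiv_eq_of_strictMono_comp {ι : Type*} {n : ℕ} {t : ι → ℝ} {e e' : Fin n ≃ ι}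
    (he : StrictMono fun i => t (e i)) (he' : StrictMono fun i => t (e' i)) : e = e' := by
  have hinj : Function.Injective t := fun a b hab => by
    have := he.injective (a₁ := e.symm a) (a₂ := e.symm b) (by simpa using hab)
    simpa using this
  have h : (fun i => t (e i)) = fun i => t (e' i) := by
    refine (StrictMono.range_inj he he').1 ?_
    rw [← Function.comp_def, ← Function.comp_def, e.surjective.range_comp, e'.surjective.range_comp]
  exact Equiv.ext fun i => hinj (congrFun h i)

open Classical in
/-- The probability of an order pattern in an i.i.d. sample is the sum over all compatible orders
of the probabilities that the sample has that order. -/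
theorem pi_setOf_pattern_eq_sum (hν : ν ∈ Kset X) {ι L : Type*} [Fintype ι] [Countable L]
    (a b : L → ι) {A : ι → Set X} (hA : ∀ i, MeasurableSet (A i)) :
    Measure.pi (fun _ : ι => ν) {z | (∀ i, (z i).2 ∈ A i) ∧ ∀ l, (z (a l)).1 < (z (b l)).1} =
      ∑ e : Fin (Fintype.card ι) ≃ ι with ∀ l, e.symm (a l) < e.symm (b l),
        Measure.pi (fun _ : Fin (Fintype.card ι) => ν)
          {z | StrictMono (fun i => (z i).1) ∧ ∀ i, (z i).2 ∈ A (e i)} := by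
  have := hν.1
  rw [← Finset.sum_congr rfl fun e _ => pi_setOf_strictMono_reindex (ν := ν) e A,
    ← measure_biUnion_finset]
  · refine measure_congr ?_
    filter_upwards [ae_injective_fst hν (ι := ι)] with z hz
    refine propext ?_
    change ((∀ i, (z i).2 ∈ A i) ∧ ∀ l, (z (a l)).1 < (z (b l)).1) ↔ z ∈ ⋃ e ∈ _, _
    simp only [Finset.mem_filter, Finset.mem_univ, true_and, Set.mem_iUnion, Set.mem_ofPred_eq,
      exists_prop]
    have key : ∀ e : Fin (Fintype.card ι) ≃ ι, StrictMono (fun i => (z (e i)).1) →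
        ∀ i j, (z i).1 < (z j).1 ↔ e.symm i < e.symm j := fun e he i j => by
      rw [← he.lt_iff_lt]
      simp
    constructor
    · rintro ⟨h1, h2⟩
      obtain ⟨e, he⟩ := exists_strictMono_comp_equiv hz
      exact ⟨e, fun l => (key e he _ _).1 (h2 l), he, h1⟩
    · rintro ⟨e, h2, he, h1⟩
      exact ⟨h1, fun l => (key e he _ _).2 (h2 l)⟩
  · intro e _ e' _ hne
    refine Set.disjoint_left.2 fun z hz hz' => hne ?_
    exact equiv_eq_of_strictMono_comp (t := fun i => (z i).1) hz.1 hz'.1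
  · intro e _
    refine MeasurableSet.inter ?_ (measurableSet_snd_mem hA)
    exact (measurable_pi_lambda (fun (z : ι → ℝ × X) i => (z (e i)).1)
      fun i => (measurable_pi_apply (e i)).fst) measurableSet_setOf_strictMono

theorem ae_fst_mem_Icc (hν : ν ∈ Kset X) {ι : Type*} [Fintype ι] :
    ∀ᵐ z ∂Measure.pi (fun _ : ι => ν), ∀ i, (z i).1 ∈ Set.Icc (0 : ℝ) 1 := by
  have := hν.1
  refine ae_all_iff.2 fun i => ?_
  have h : ∀ᵐ t ∂ν.fst, t ∈ Set.Icc (0 : ℝ) 1 := by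
    rw [hν.2]
    exact ae_restrict_mem measurableSet_Icc
  have h2 : ∀ᵐ y ∂ν, y.1 ∈ Set.Icc (0 : ℝ) 1 := ae_of_ae_map measurable_fst.aemeasurable h
  exact (Measure.quasiMeasurePreserving_eval (fun _ : ι => ν) i).ae h2

/-- Monomials in the time coordinates are probabilities that further sample points come earlier. -/
theorem setLIntegral_monomial_eq (hν : ν ∈ Kset X) {ι : Type*} [Fintype ι] {n : ℕ}
    (r : Fin n → ι) {A : ι → Set X} (hA : ∀ i, MeasurableSet (A i)) :
    ∫⁻ z in {z | ∀ i, (z i).2 ∈ A i}, ∏ l, ENNReal.ofReal (z (r l)).1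
        ∂Measure.pi (fun _ : ι => ν) =
      Measure.pi (fun _ : ι ⊕ Fin n => ν)
        {z | (∀ i, (z i).2 ∈ (Sum.elim A (fun _ => Set.univ) : ι ⊕ Fin n → Set X) i) ∧
          ∀ l, (z (Sum.inr l)).1 < (z (Sum.inl (r l))).1} := by
  have := hν.1
  rw [← (measurePreserving_sumPiEquivProdPi_symm
    (fun _ : ι ⊕ Fin n => ν)).measure_preimage_equiv]
  have hset : (MeasurableEquiv.sumPiEquivProdPi fun _ : ι ⊕ Fin n => ℝ × X).symm ⁻¹'
      {z | (∀ i, (z i).2 ∈ (Sum.elim A (fun _ => Set.univ) : ι ⊕ Fin n → Set X) i) ∧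
          ∀ l, (z (Sum.inr l)).1 < (z (Sum.inl (r l))).1} =
      {p : (ι → ℝ × X) × (Fin n → ℝ × X) |
        (∀ i, (p.1 i).2 ∈ A i) ∧ ∀ l, (p.2 l).1 < (p.1 (r l)).1} := by
    ext p
    simp only [Set.mem_preimage, Set.mem_ofPred_eq, Sum.forall, Sum.elim_inl, Sum.elim_inr,
      Set.mem_univ, implies_true, and_true]
    rfl
  have hmeas : MeasurableSet {p : (ι → ℝ × X) × (Fin n → ℝ × X) |
        (∀ i, (p.1 i).2 ∈ A i) ∧ ∀ l, (p.2 l).1 < (p.1 (r l)).1} := by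
    refine MeasurableSet.inter (measurable_fst (measurableSet_snd_mem hA)) ?_
    change MeasurableSet {p : (ι → ℝ × X) × (Fin n → ℝ × X) | ∀ l, (p.2 l).1 < (p.1 (r l)).1}
    rw [Set.ofPred_forall]
    exact MeasurableSet.iInter fun l => measurableSet_lt
      ((measurable_pi_apply l).comp measurable_snd).fst
      ((measurable_pi_apply (r l)).comp measurable_fst).fst
  rw [hset, Measure.prod_apply hmeas, ← lintegral_indicator (measurableSet_snd_mem hA)]
  refine lintegral_congr_ae ?_
  filter_upwards [ae_fst_mem_Icc hν] with z hz
  by_cases hzA : ∀ i, (z i).2 ∈ A i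
  · rw [Set.indicator_of_mem (show z ∈ {z : ι → ℝ × X | ∀ i, (z i).2 ∈ A i} from hzA)]
    have hsec : Prod.mk z ⁻¹' {p : (ι → ℝ × X) × (Fin n → ℝ × X) |
        (∀ i, (p.1 i).2 ∈ A i) ∧ ∀ l, (p.2 l).1 < (p.1 (r l)).1} =
        Set.univ.pi fun l => Prod.fst ⁻¹' Set.Iio (z (r l)).1 := by
      ext w
      simp [hzA]
    rw [hsec, Measure.pi_pi]
    refine Finset.prod_congr rfl fun l _ => ?_
    rw [← Measure.fst_apply measurableSet_Iio, hν.2, Measure.restrict_apply measurableSet_Iio]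
    have : Set.Iio (z (r l)).1 ∩ Set.Icc 0 1 = Set.Ico 0 (z (r l)).1 := by
      ext t
      simp only [Set.mem_inter_iff, Set.mem_Iio, Set.mem_Icc, Set.mem_Ico]
      exact ⟨fun h => ⟨h.2.1, h.1⟩, fun h => ⟨h.2, h.1, h.2.le.trans (hz (r l)).2⟩⟩
    rw [this, Real.volume_Ico, sub_zero]
  · rw [Set.indicator_of_notMem (show z ∉ {z : ι → ℝ × X | ∀ i, (z i).2 ∈ A i} from hzA)]
    have hsec : Prod.mk z ⁻¹' {p : (ι → ℝ × X) × (Fin n → ℝ × X) |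
        (∀ i, (p.1 i).2 ∈ A i) ∧ ∀ l, (p.2 l).1 < (p.1 (r l)).1} = ∅ := by
      ext w
      simp only [Set.mem_preimage, Set.mem_ofPred_eq, Set.mem_empty_iff_false, iff_false]
      exact fun h => hzA h.1
    rw [hsec, measure_empty]

end Pointwise

theorem aemeasurable_pi_const {Y ι : Type*} [MeasurableSpace Y] [Fintype ι]
    {P : Measure (Measure Y)} (hP : ∀ᵐ ν ∂P, IsProbabilityMeasure ν) :
    AEMeasurable (fun ν => Measure.pi fun _ : ι => ν) P := by
  classical
  let q : Measure Y → Measure Y := fun ν => if ν Set.univ = 1 then ν else 0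
  have hq : Measurable q := Measurable.ite
    (Measure.measurable_coe MeasurableSet.univ (measurableSet_singleton 1)) measurable_id
    measurable_const
  have hfin : ∀ ν, IsFiniteMeasure (q ν) := fun ν => by
    by_cases h : ν Set.univ = 1
    · exact ⟨by simp [q, h]⟩
    · simp only [q, h, if_false]
      infer_instance
  refine ⟨fun ν => Measure.pi fun _ : ι => q ν, ?_, ?_⟩
  · have hbox : ∀ s : ι → Set Y, (∀ i, MeasurableSet (s i)) →
        Measurable fun ν => Measure.pi (fun _ : ι => q ν) (Set.univ.pi s) := fun s hs => by
      simp only [Measure.pi_pi]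
      exact Finset.measurable_prod _ fun i _ => (Measure.measurable_coe (hs i)).comp hq
    refine Measurable.measure_of_isPiSystem generateFrom_pi.symm isPiSystem_pi ?_ ?_
    · rintro _ ⟨s, hs, rfl⟩
      exact hbox s fun i => hs i trivial
    · rw [← Set.pi_univ Set.univ]
      exact hbox _ fun _ => MeasurableSet.univ
  · filter_upwards [hP] with ν hν
    simp [q]

/-- A law of random probability measures is determined by the joint moments of the random masses
of measurable sets. -/
theorem ext_of_lintegral_prod_apply {Y : Type*} [MeasurableSpace Y] {P P' : Measure (Measure Y)}
    [IsProbabilityMeasure P] [IsProbabilityMeasure P']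
    (hP : ∀ᵐ ν ∂P, IsProbabilityMeasure ν) (hP' : ∀ᵐ ν ∂P', IsProbabilityMeasure ν)
    (h : ∀ (n : ℕ) (S : Fin n → Set Y), (∀ l, MeasurableSet (S l)) →
      ∫⁻ ν, ∏ l, ν (S l) ∂P = ∫⁻ ν, ∏ l, ν (S l) ∂P') :
    P = P' := by
  refine ext_of_generate_finite _ (generateFrom_piiUnionInter_measurableSet
    (fun s : Set Y => (borel ℝ≥0∞).comap fun ν : Measure Y => ν s) {s | MeasurableSet s}).symm
    (isPiSystem_piiUnionInter _ (fun s => @MeasurableSpace.isPiSystem_measurableSet _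
      ((borel ℝ≥0∞).comap fun ν : Measure Y => ν s)) _) ?_
    (by simp)
  rintro _ ⟨t, ht, f, hf, rfl⟩
  let F : Measure Y → t → ℝ := fun ν s => (ν (s : Set Y)).toReal
  have hF : Measurable F := measurable_pi_lambda _ fun s =>
    (Measure.measurable_coe (ht s.2)).ennreal_toReal
  have hIcc : ∀ ρ : Measure (Measure Y), (∀ᵐ ν ∂ρ, IsProbabilityMeasure ν) →
      ∀ᵐ x ∂ρ.map F, ∀ s, x s ∈ Set.Icc (0 : ℝ) 1 := fun ρ hρ => by
    refine (ae_map_iff hF.aemeasurable ?_).2 (hρ.mono fun ν _ s => ?_)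
    · rw [Set.ofPred_forall]
      exact MeasurableSet.iInter fun s => measurable_pi_apply s measurableSet_Icc
    · exact ⟨ENNReal.toReal_nonneg, measureReal_le_one⟩
  have hint : ∀ ρ : Measure (Measure Y), (∀ᵐ ν ∂ρ, IsProbabilityMeasure ν) →
      ∀ (n : ℕ) (r : Fin n → t), ∫⁻ x, ∏ l, ENNReal.ofReal (x (r l)) ∂ρ.map F =
        ∫⁻ ν, ∏ l, ν (r l : Set Y) ∂ρ := fun ρ hρ n r => by
    rw [lintegral_map (by fun_prop) hF]
    refine lintegral_congr_ae (hρ.mono fun ν _ => Finset.prod_congr rfl fun l _ => ?_)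
    exact ENNReal.ofReal_toReal (measure_ne_top _ _)
  have hmap : P.map F = P'.map F := by
    refine ext_of_lintegral_monomial _ _ (hIcc P hP) (hIcc P' hP') fun n r => ?_
    rw [hint P hP, hint P' hP', h n (fun l => (r l : Set Y)) fun l => ht (r l).2]
  choose! G hG hGf using hf
  let T : Set (t → ℝ) := ⋂ s : t, {x | ENNReal.ofReal (x s) ∈ G s}
  have hT : MeasurableSet T := MeasurableSet.iInter fun s =>
    (ENNReal.measurable_ofReal.comp (measurable_pi_apply s))
      (by rw [BorelSpace.measurable_eq (α := ℝ≥0∞)]; exact hG s s.2)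
  have hval : ∀ ρ : Measure (Measure Y), (∀ᵐ ν ∂ρ, IsProbabilityMeasure ν) →
      ρ (⋂ s ∈ t, f s) = ρ.map F T := fun ρ hρ => by
    rw [Measure.map_apply hF hT]
    refine measure_congr ?_
    filter_upwards [hρ] with ν _
    refine propext ?_
    change ν ∈ (⋂ s ∈ t, f s) ↔ F ν ∈ T
    simp only [Set.mem_iInter, T, F, Set.mem_ofPred_eq, Subtype.forall,
      ENNReal.ofReal_toReal (measure_ne_top ν _)]
    refine forall₂_congr fun s hs => ?_
    rw [← hGf s hs, Set.mem_preimage]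
  rw [hval P hP, hval P' hP', hmap]

section Mixture

variable {X : Type*} [MeasurableSpace X] {P P' : Measure (Measure (ℝ × X))}

theorem lintegral_setLIntegral_monomial_eq
    (hP : ∀ᵐ ν ∂P, ν ∈ Kset X) (hP' : ∀ᵐ ν ∂P', ν ∈ Kset X)
    (H : ∀ (n : ℕ) (A : Fin n → Set X), (∀ i, MeasurableSet (A i)) →
      ∫⁻ ν, Measure.pi (fun _ : Fin n => ν)
          {z | StrictMono (fun i => (z i).1) ∧ ∀ i, (z i).2 ∈ A i} ∂P =
        ∫⁻ ν, Measure.pi (fun _ : Fin n => ν)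
          {z | StrictMono (fun i => (z i).1) ∧ ∀ i, (z i).2 ∈ A i} ∂P')
    {ι : Type*} [Fintype ι] {n : ℕ} (r : Fin n → ι) {A : ι → Set X}
    (hA : ∀ i, MeasurableSet (A i)) :
    ∫⁻ ν, ∫⁻ z in {z | ∀ i, (z i).2 ∈ A i}, ∏ l, ENNReal.ofReal (z (r l)).1
        ∂Measure.pi (fun _ : ι => ν) ∂P =
      ∫⁻ ν, ∫⁻ z in {z | ∀ i, (z i).2 ∈ A i}, ∏ l, ENNReal.ofReal (z (r l)).1
        ∂Measure.pi (fun _ : ι => ν) ∂P' := by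
  classical
  let B : ι ⊕ Fin n → Set X := Sum.elim A fun _ => Set.univ
  have hB : ∀ i, MeasurableSet (B i) := by
    rintro (i | i)
    exacts [hA i, MeasurableSet.univ]
  have key : ∀ ρ : Measure (Measure (ℝ × X)), (∀ᵐ ν ∂ρ, ν ∈ Kset X) →
      ∫⁻ ν, ∫⁻ z in {z | ∀ i, (z i).2 ∈ A i}, ∏ l, ENNReal.ofReal (z (r l)).1
          ∂Measure.pi (fun _ : ι => ν) ∂ρ =
        ∑ e : Fin (Fintype.card (ι ⊕ Fin n)) ≃ ι ⊕ Fin n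
            with ∀ l, e.symm (Sum.inr l) < e.symm (Sum.inl (r l)),
          ∫⁻ ν, Measure.pi (fun _ : Fin (Fintype.card (ι ⊕ Fin n)) => ν)
            {z | StrictMono (fun i => (z i).1) ∧ ∀ i, (z i).2 ∈ B (e i)} ∂ρ := by
    intro ρ hρ
    rw [← lintegral_finsetSum']
    · refine lintegral_congr_ae (hρ.mono fun ν hν => ?_)
      simp only
      rw [setLIntegral_monomial_eq hν r hA, pi_setOf_pattern_eq_sum hν _ _ hB]
      congr!
    · intro e _
      refine (Measure.measurable_coe ?_).comp_aemeasurable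
        (aemeasurable_pi_const (hρ.mono fun ν hν => hν.1))
      exact MeasurableSet.inter (measurable_fst_comp measurableSet_setOf_strictMono)
        (measurableSet_snd_mem fun i => hB (e i))
  rw [key P hP, key P' hP']
  exact Finset.sum_congr rfl fun e _ => H _ _ fun i => hB (e i)

theorem bind_pi_eq_bind_pi [IsProbabilityMeasure P] [IsProbabilityMeasure P']
    (hP : ∀ᵐ ν ∂P, ν ∈ Kset X) (hP' : ∀ᵐ ν ∂P', ν ∈ Kset X)
    (H : ∀ (n : ℕ) (A : Fin n → Set X), (∀ i, MeasurableSet (A i)) →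
      ∫⁻ ν, Measure.pi (fun _ : Fin n => ν)
          {z | StrictMono (fun i => (z i).1) ∧ ∀ i, (z i).2 ∈ A i} ∂P =
        ∫⁻ ν, Measure.pi (fun _ : Fin n => ν)
          {z | StrictMono (fun i => (z i).1) ∧ ∀ i, (z i).2 ∈ A i} ∂P')
    (ι : Type*) [Fintype ι] :
    P.bind (fun ν => Measure.pi fun _ : ι => ν) = P'.bind fun ν => Measure.pi fun _ : ι => ν := by
  have hmeas : ∀ ρ : Measure (Measure (ℝ × X)), (∀ᵐ ν ∂ρ, ν ∈ Kset X) →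
      AEMeasurable (fun ν => Measure.pi fun _ : ι => ν) ρ := fun ρ hρ =>
    aemeasurable_pi_const (hρ.mono fun ν hν => hν.1)
  have huniv : ∀ ρ : Measure (Measure (ℝ × X)), IsProbabilityMeasure ρ →
      (∀ᵐ ν ∂ρ, ν ∈ Kset X) →
      IsProbabilityMeasure (ρ.bind fun ν => Measure.pi fun _ : ι => ν) := by
    intro ρ _ hρ
    refine ⟨?_⟩
    rw [Measure.bind_apply MeasurableSet.univ (hmeas ρ hρ)]
    calc ∫⁻ ν, Measure.pi (fun _ : ι => ν) Set.univ ∂ρ = ∫⁻ _, 1 ∂ρ :=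
          lintegral_congr_ae (hρ.mono fun ν hν => by
            have := hν.1
            exact measure_univ)
      _ = 1 := by simp
  have := huniv P ‹_› hP
  have := huniv P' ‹_› hP'
  have hlaw : ∀ A : ι → Set X, (∀ i, MeasurableSet (A i)) →
      ((P.bind fun ν => Measure.pi fun _ : ι => ν).restrict {z | ∀ i, (z i).2 ∈ A i}).map
          (fun z i => (z i).1) =
        ((P'.bind fun ν => Measure.pi fun _ : ι => ν).restrict {z | ∀ i, (z i).2 ∈ A i}).map
          (fun z i => (z i).1) := by
    intro A hA
    have hIcc : ∀ ρ : Measure (Measure (ℝ × X)), (∀ᵐ ν ∂ρ, ν ∈ Kset X) →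
        ∀ᵐ x ∂((ρ.bind fun ν => Measure.pi fun _ : ι => ν).restrict
          {z | ∀ i, (z i).2 ∈ A i}).map (fun z i => (z i).1), ∀ i, x i ∈ Set.Icc (0 : ℝ) 1 := by
      intro ρ hρ
      have hS : MeasurableSet {x : ι → ℝ | ∀ i, x i ∈ Set.Icc (0 : ℝ) 1} := by
        rw [Set.ofPred_forall]
        exact MeasurableSet.iInter fun s => measurable_pi_apply s measurableSet_Icc
      refine (ae_map_iff measurable_fst_comp.aemeasurable hS).2 (ae_restrict_of_ae ?_)
      change (ρ.bind fun ν => Measure.pi fun _ : ι => ν)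
        ((fun (z : ι → ℝ × X) i => (z i).1) ⁻¹' {x | ∀ i, x i ∈ Set.Icc (0 : ℝ) 1})ᶜ = 0
      rw [Measure.bind_apply (measurable_fst_comp hS).compl (hmeas ρ hρ)]
      refine (lintegral_congr_ae (hρ.mono fun ν hν => ?_)).trans lintegral_zero
      exact ae_iff.1 (ae_fst_mem_Icc hν)
    refine ext_of_lintegral_monomial _ _ (hIcc P hP) (hIcc P' hP') fun n r => ?_
    have hint : ∀ ρ : Measure (Measure (ℝ × X)), (∀ᵐ ν ∂ρ, ν ∈ Kset X) →
        ∫⁻ x, ∏ l, ENNReal.ofReal (x (r l)) ∂((ρ.bind fun ν =>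
          Measure.pi fun _ : ι => ν).restrict {z | ∀ i, (z i).2 ∈ A i}).map
            (fun z i => (z i).1) =
          ∫⁻ ν, ∫⁻ z in {z | ∀ i, (z i).2 ∈ A i}, ∏ l, ENNReal.ofReal (z (r l)).1
            ∂Measure.pi (fun _ : ι => ν) ∂ρ := by
      intro ρ hρ
      have hprod : Measurable fun z : ι → ℝ × X => ∏ l, ENNReal.ofReal (z (r l)).1 := by fun_prop
      rw [lintegral_map (by fun_prop) measurable_fst_comp,
        ← lintegral_indicator (measurableSet_snd_mem hA), Measure.lintegral_bind (hmeas ρ hρ)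
          (hprod.indicator (measurableSet_snd_mem hA)).aemeasurable]
      exact lintegral_congr fun ν => lintegral_indicator (measurableSet_snd_mem hA) _
    rw [hint P hP, hint P' hP', lintegral_setLIntegral_monomial_eq hP hP' H r hA]
  have hspan : IsCountablySpanning (Set.image2 (· ×ˢ ·) {s : Set ℝ | MeasurableSet s}
      {t : Set X | MeasurableSet t}) :=
    isCountablySpanning_measurableSet.prod isCountablySpanning_measurableSet
  refine ext_of_generate_finite _
    (generateFrom_eq_pi (fun _ => generateFrom_prod) fun _ => hspan).symm
    (IsPiSystem.pi fun _ => isPiSystem_prod) ?_ (by simp)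
  rintro _ ⟨S, hS, rfl⟩
  choose E hE A hA hEA using fun i => hS i (Set.mem_univ i)
  have hset : Set.univ.pi S = (fun (z : ι → ℝ × X) i => (z i).1) ⁻¹' Set.univ.pi E ∩
      {z | ∀ i, (z i).2 ∈ A i} := by
    ext z
    simp only [Set.mem_univ_pi, ← hEA, Set.mem_prod, Set.mem_inter_iff, Set.mem_preimage,
      Set.mem_ofPred_eq, forall_and]
  have hbox : MeasurableSet (Set.univ.pi E) := MeasurableSet.univ_pi hE
  rw [hset, ← Measure.restrict_apply (measurable_fst_comp hbox),
    ← Measure.restrict_apply (measurable_fst_comp hbox),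
    ← Measure.map_apply measurable_fst_comp hbox, ← Measure.map_apply measurable_fst_comp hbox,
    hlaw A hA]

theorem eq_of_lintegral_pi_setOf_strictMono_eq [IsProbabilityMeasure P] [IsProbabilityMeasure P']
    (hP : ∀ᵐ ν ∂P, ν ∈ Kset X) (hP' : ∀ᵐ ν ∂P', ν ∈ Kset X)
    (H : ∀ (n : ℕ) (A : Fin n → Set X), (∀ i, MeasurableSet (A i)) →
      ∫⁻ ν, Measure.pi (fun _ : Fin n => ν)
          {z | StrictMono (fun i => (z i).1) ∧ ∀ i, (z i).2 ∈ A i} ∂P =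
        ∫⁻ ν, Measure.pi (fun _ : Fin n => ν)
          {z | StrictMono (fun i => (z i).1) ∧ ∀ i, (z i).2 ∈ A i} ∂P') :
    P = P' := by
  refine ext_of_lintegral_prod_apply (hP.mono fun ν hν => hν.1) (hP'.mono fun ν hν => hν.1)
    fun n S hS => ?_
  have key : ∀ ρ : Measure (Measure (ℝ × X)), (∀ᵐ ν ∂ρ, ν ∈ Kset X) →
      ∫⁻ ν, ∏ l, ν (S l) ∂ρ =
        (ρ.bind fun ν => Measure.pi fun _ : Fin n => ν) (Set.univ.pi S) := fun ρ hρ => by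
    rw [Measure.bind_apply (MeasurableSet.univ_pi hS)
      (aemeasurable_pi_const (hρ.mono fun ν hν => hν.1))]
    refine lintegral_congr_ae (hρ.mono fun ν hν => ?_)
    have := hν.1
    exact (Measure.pi_pi _ _).symm
  rw [key P hP, key P' hP', bind_pi_eq_bind_pi hP hP' H]

end Mixture

theorem lintegral_pi_setOf_strictMono_eq {X : Type*} [MeasurableSpace X]
    {P : Measure (Measure (ℝ × X))} {κ : Measure (ℝ × X) → ℝ → Measure X}
    (hP : ∀ᵐ ν ∂P, ν ∈ Kset X) (hκ : IsDisintegration κ) {n : ℕ} {A : Fin n → Set X}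
    (hA : ∀ i, MeasurableSet (A i)) :
    ∫⁻ ν, Measure.pi (fun _ : Fin n => ν)
        {z | StrictMono (fun i => (z i).1) ∧ ∀ i, (z i).2 ∈ A i} ∂P =
      (Nat.factorial n : ℝ≥0∞)⁻¹ * ∫⁻ ν in Kset X, (Nat.factorial n : ℝ≥0∞) *
        ∫⁻ t in simplexSet n, ∏ i, κ ν (t i) (A i) ∂volume ∂P := by
  have h0 : (Nat.factorial n : ℝ≥0∞) ≠ 0 := by exact_mod_cast n.factorial_ne_zero
  have htop : (Nat.factorial n : ℝ≥0∞) ≠ ∞ := ENNReal.natCast_ne_top _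
  rw [Measure.restrict_eq_self_of_ae_mem hP, lintegral_const_mul' _ _ htop, ← mul_assoc,
    ENNReal.inv_mul_cancel h0 htop, one_mul]
  exact lintegral_congr_ae (hP.mono fun ν hν => (lintegral_simplexSet_eq hκ hν hA).symm)

/-- **Uniqueness of the mixing measure in the representation theorem.**
If `P₁` and `P₂` are Borel probability measures on measures on `[0,1] × 𝒳`, each concentrated
on `𝒦`, and each representing the same thinning-invariant sequence `(μ_n)` via
`μ_n(A₁×⋯×A_n) = ∫_𝒦 n! ∫_{Δⁿ} ∏ᵢ ν_{tᵢ}(Aᵢ) dt dP_j(ν)`, then `P₁ = P₂`. -/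
theorem thinning_invariant_representation_unique
    {X : Type*} [MetricSpace X] [CompactSpace X] [MeasurableSpace X] [BorelSpace X]
    (μ : (n : ℕ) → Measure (Fin n → X))
    (hprob : ∀ n, 1 ≤ n → IsProbabilityMeasure (μ n))
    (hthin : ∀ k n, 1 ≤ k → k ≤ n → thinTrans k n (μ n) = μ k)
    (P₁ P₂ : Measure (Measure (ℝ × X)))
    (κ₁ κ₂ : Measure (ℝ × X) → ℝ → Measure X)
    (hP₁ : IsProbabilityMeasure P₁) (hP₂ : IsProbabilityMeasure P₂)
    (hc₁ : P₁ (Kset X)ᶜ = 0) (hc₂ : P₂ (Kset X)ᶜ = 0)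
    (hκ₁ : IsDisintegration κ₁) (hκ₂ : IsDisintegration κ₂)
    (hrep₁ : ∀ n, 1 ≤ n → ∀ A : Fin n → Set X, (∀ i, MeasurableSet (A i)) →
      μ n (Set.univ.pi A) =
        ∫⁻ ν in Kset X,
          (Nat.factorial n : ℝ≥0∞) *
            ∫⁻ t in simplexSet n, ∏ i, κ₁ ν (t i) (A i) ∂volume ∂P₁)
    (hrep₂ : ∀ n, 1 ≤ n → ∀ A : Fin n → Set X, (∀ i, MeasurableSet (A i)) →
      μ n (Set.univ.pi A) =
        ∫⁻ ν in Kset X,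
          (Nat.factorial n : ℝ≥0∞) *
            ∫⁻ t in simplexSet n, ∏ i, κ₂ ν (t i) (A i) ∂volume ∂P₂) :
    P₁ = P₂ := by
  have hK₁ : ∀ᵐ ν ∂P₁, ν ∈ Kset X := ae_iff.2 hc₁
  have hK₂ : ∀ᵐ ν ∂P₂, ν ∈ Kset X := ae_iff.2 hc₂
  refine eq_of_lintegral_pi_setOf_strictMono_eq hK₁ hK₂ fun n A hA => ?_
  rcases Nat.eq_zero_or_pos n with rfl | hn
  · have e : {z : Fin 0 → ℝ × X | StrictMono (fun i => (z i).1) ∧ ∀ i, (z i).2 ∈ A i} =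
        Set.univ := by
      ext z
      simp [StrictMono]
    rw [e]
    simp
  · rw [lintegral_pi_setOf_strictMono_eq hK₁ hκ₁ hA, lintegral_pi_setOf_strictMono_eq hK₂ hκ₂ hA,
      ← hrep₁ n hn A hA, ← hrep₂ n hn A hA]
end

section
/- Let 𝒳 be a compact metric space and let κ : [0,1] → M₁(𝒳) be a Borel measurable family of probability measures (a Markov kernel from [0,1] with Lebesgue measure to 𝒳). For each n ≥ 1 define μ_n ∈ M₁(𝒳^n) by μ_n(A₁×⋯×A_n) = n! ∫_{Δⁿ} ∏_{i=1}^n κ_{t_i}(A_i) dt₁⋯dt_n for Borel A₁,…,A_n ⊆ 𝒳, where Δⁿ = {0 < t₁ < ⋯ < t_n < 1}. Then the sequence (μ_n)_{n≥1} is thinning-invariant. -/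
open MeasureTheory
open scoped ENNReal

/-- The preimage of a box under the reindexing `x ↦ x ∘ ι` along an injection `ι` is a box. -/
theorem preimage_comp_univ_pi {ι κ X : Type*} {e : ι → κ} (he : Function.Injective e)
    (B : ι → Set X) :
    (fun x : κ → X => x ∘ e) ⁻¹' Set.univ.pi B =
      Set.univ.pi (Function.extend e B fun _ => Set.univ) := by
  ext x
  simp only [Set.mem_preimage, Set.mem_univ_pi, Function.comp_apply]
  refine ⟨fun h j => ?_, fun h i => ?_⟩
  · by_cases hj : ∃ i, e i = j
    · obtain ⟨i, rfl⟩ := hj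
      rw [he.extend_apply]
      exact h i
    · rw [Function.extend_apply' _ _ _ hj]
      trivial
  · have := h (e i)
    rwa [he.extend_apply] at this

theorem measurableSet_extend_univ {ι κ X : Type*} [MeasurableSpace X] {e : ι → κ}
    (he : Function.Injective e) {B : ι → Set X} (hB : ∀ i, MeasurableSet (B i)) (j : κ) :
    MeasurableSet (Function.extend e B (fun _ => Set.univ) j) := by
  by_cases hj : ∃ i, e i = j
  · obtain ⟨i, rfl⟩ := hj
    rw [he.extend_apply]
    exact hB i
  · rw [Function.extend_apply' _ _ _ hj]
    exact MeasurableSet.univ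

theorem prod_measure_extend_univ {ι κ X : Type*} [Fintype ι] [Fintype κ] [MeasurableSpace X]
    {e : ι → κ} (he : Function.Injective e) (m : κ → Measure X)
    [∀ j, IsProbabilityMeasure (m j)] (B : ι → Set X) :
    ∏ j, m j (Function.extend e B (fun _ => Set.univ) j) = ∏ i, m (e i) (B i) := by
  refine (Fintype.prod_of_injective e he _ _ (fun j hj => ?_) fun i => ?_).symm
  · rw [Function.extend_apply' _ _ _ hj, measure_univ]
  · rw [he.extend_apply]

/-- Reindexing along an injection maps a power of a probability measure to a power of the same
measure. -/
theorem measurePreserving_comp_injective {ι κ X : Type*} [Fintype ι] [Fintype κ]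
    [MeasurableSpace X] (m : Measure X) [IsProbabilityMeasure m] {e : ι → κ}
    (he : Function.Injective e) :
    MeasurePreserving (fun x : κ → X => x ∘ e) (Measure.pi fun _ => m) (Measure.pi fun _ => m) := by
  have hmeas : Measurable fun x : κ → X => x ∘ e :=
    measurable_pi_lambda _ fun i => measurable_pi_apply (e i)
  refine ⟨hmeas, (Measure.pi_eq fun B hB => ?_).symm⟩
  rw [Measure.map_apply hmeas (MeasurableSet.univ_pi hB), preimage_comp_univ_pi he,
    Measure.pi_pi, prod_measure_extend_univ he (fun _ => m)]

/-- The uniform distribution on the open unit cube. -/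
noncomputable def cubeMeasure (n : ℕ) : Measure (Fin n → ℝ) :=
  Measure.pi fun _ => volume.restrict (Set.Ioo (0 : ℝ) 1)

instance isProbabilityMeasure_restrict_Ioo_zero_one :
    IsProbabilityMeasure (volume.restrict (Set.Ioo (0 : ℝ) 1)) :=
  ⟨by simp⟩

theorem cubeMeasure_eq_restrict (n : ℕ) :
    cubeMeasure n = volume.restrict (Set.univ.pi fun _ => Set.Ioo (0 : ℝ) 1) := by
  rw [cubeMeasure, volume_pi, Measure.restrict_pi_pi]

theorem measurableSet_strictMono (n : ℕ) : MeasurableSet {t : Fin n → ℝ | StrictMono t} := by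
  have : {t : Fin n → ℝ | StrictMono t} =
      ⋂ (i : Fin n) (j : Fin n) (_ : i < j), {t | t i < t j} := by
    ext t
    simp [StrictMono]
  rw [this]
  exact MeasurableSet.iInter fun i => MeasurableSet.iInter fun j => MeasurableSet.iInter fun _ =>
    measurableSet_lt (measurable_pi_apply i) (measurable_pi_apply j)

theorem setLIntegral_simplexSet (n : ℕ) (f : (Fin n → ℝ) → ℝ≥0∞) :
    ∫⁻ t in simplexSet n, f t = ∫⁻ t, {t | StrictMono t}.indicator f t ∂cubeMeasure n := by
  rw [lintegral_indicator (measurableSet_strictMono n), cubeMeasure_eq_restrict,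
    Measure.restrict_restrict (measurableSet_strictMono n)]
  congr 2
  ext t
  simp [simplexSet]

theorem ae_injective_cubeMeasure (n : ℕ) : ∀ᵐ t ∂cubeMeasure n, Function.Injective t := by
  have hne : ∀ i j : Fin n, i ≠ j → ∀ᵐ t : Fin n → ℝ, t i ≠ t j := by
    intro i j hij
    let s : Submodule ℝ (Fin n → ℝ) :=
      LinearMap.ker (LinearMap.proj (R := ℝ) (φ := fun _ : Fin n => ℝ) i - LinearMap.proj j)
    have hs : s ≠ ⊤ := fun h => by
      have : Pi.single i (1 : ℝ) ∈ s := h ▸ Submodule.mem_top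
      simp [s, hij.symm] at this
    have h0 := Measure.addHaar_submodule (volume : Measure (Fin n → ℝ)) s hs
    rw [ae_iff]
    refine measure_mono_null (fun t ht => ?_) h0
    have : t i = t j := by simpa using ht
    simp [s, this]
  rw [cubeMeasure_eq_restrict]
  refine ae_restrict_of_ae ?_
  have hall : ∀ᵐ t : Fin n → ℝ, ∀ i j : Fin n, i ≠ j → t i ≠ t j := by
    simp only [ae_all_iff]
    exact hne
  filter_upwards [hall] with t ht i j hij
  by_contra h
  exact ht i j h hij

/-- Exactly one rearrangement of an injective tuple is strictly increasing. -/
theorem sum_perm_indicator_strictMono {n : ℕ} {t : Fin n → ℝ} (ht : Function.Injective t)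
    (c : ℝ≥0∞) :
    ∑ σ : Equiv.Perm (Fin n), {s : Fin n → ℝ | StrictMono s}.indicator (fun _ => c) (t ∘ σ) =
      c := by
  rw [Finset.sum_eq_single (Tuple.sort t)]
  · exact Set.indicator_of_mem
      ((Tuple.monotone_sort t).strictMono_of_injective (ht.comp (Tuple.sort t).injective)) _
  · intro σ _ hσ
    refine Set.indicator_of_notMem (fun h => hσ ?_) _
    have hσ' : StrictMono (t ∘ σ) := h
    have heq := Tuple.unique_monotone hσ'.monotone (Tuple.monotone_sort t)
    exact Equiv.ext fun i => ht (congrFun heq i)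
  · simp

/-- The integral of a symmetric function over the cube is `n!` times its integral over the
simplex. -/
theorem factorial_mul_lintegral_indicator_strictMono {n : ℕ} {H : (Fin n → ℝ) → ℝ≥0∞}
    (hH : Measurable H) (hsymm : ∀ (σ : Equiv.Perm (Fin n)) t, H (t ∘ σ) = H t) :
    (n.factorial : ℝ≥0∞) * ∫⁻ t, {t | StrictMono t}.indicator H t ∂cubeMeasure n =
      ∫⁻ t, H t ∂cubeMeasure n := by
  have hI : Measurable ({t | StrictMono t}.indicator H) :=
    hH.indicator (measurableSet_strictMono n)
  have hperm : ∀ σ : Equiv.Perm (Fin n),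
      MeasurePreserving (fun t : Fin n → ℝ => t ∘ σ) (cubeMeasure n) (cubeMeasure n) :=
    fun σ => measurePreserving_comp_injective _ σ.injective
  calc (n.factorial : ℝ≥0∞) * ∫⁻ t, {t | StrictMono t}.indicator H t ∂cubeMeasure n
      = ∑ σ : Equiv.Perm (Fin n),
          ∫⁻ t, {t | StrictMono t}.indicator H (t ∘ σ) ∂cubeMeasure n := by
        simp_rw [fun σ => (hperm σ).lintegral_comp hI]
        simp [Fintype.card_perm]
    _ = ∫⁻ t, ∑ σ : Equiv.Perm (Fin n),
          {t | StrictMono t}.indicator H (t ∘ σ) ∂cubeMeasure n :=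
        (lintegral_finsetSum _ fun σ _ => hI.comp (hperm σ).measurable).symm
    _ = ∫⁻ t, H t ∂cubeMeasure n := by
        refine lintegral_congr_ae ?_
        filter_upwards [ae_injective_cubeMeasure n] with t ht
        rw [← sum_perm_indicator_strictMono ht (H t)]
        refine Finset.sum_congr rfl fun σ _ => ?_
        by_cases h : t ∘ σ ∈ {s : Fin n → ℝ | StrictMono s}
        · rw [Set.indicator_of_mem h, Set.indicator_of_mem h, hsymm]
        · rw [Set.indicator_of_notMem h, Set.indicator_of_notMem h]

open Classical in
/-- On strictly increasing tuples, the sum of `g` over increasing subtuples is the sum over all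
injective subtuples of the restriction of `g` to increasing tuples. -/
theorem sum_strictMono_comp {k n : ℕ} (g : (Fin k → ℝ) → ℝ≥0∞) {t : Fin n → ℝ}
    (ht : StrictMono t) :
    ∑ ι : {ι : Fin k → Fin n // StrictMono ι}, g (t ∘ ι.1) =
      ∑ e : Fin k ↪ Fin n, {s | StrictMono s}.indicator g (t ∘ e) := by
  refine Fintype.sum_of_injective (fun ι => ⟨ι.1, ι.2.injective⟩)
    (fun ι ι' h => Subtype.ext (congrArg DFunLike.coe h)) _ _ (fun e he => ?_) fun ι => ?_
  · refine Set.indicator_of_notMem (fun h => he ⟨⟨e, fun i j hij => ?_⟩, rfl⟩) _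
    exact ht.lt_iff_lt.1 (h hij)
  · exact (Set.indicator_of_mem (ht.comp ι.2) g).symm

open Classical in
theorem factorial_mul_sum_setLIntegral_comp {k n : ℕ} {g : (Fin k → ℝ) → ℝ≥0∞}
    (hg : Measurable g) :
    (n.factorial : ℝ≥0∞) *
        ∑ ι : {ι : Fin k → Fin n // StrictMono ι}, ∫⁻ t in simplexSet n, g (t ∘ ι.1) =
      n.descFactorial k * ∫⁻ s in simplexSet k, g s := by
  have hF : Measurable ({s | StrictMono s}.indicator g) :=
    hg.indicator (measurableSet_strictMono k)
  have hcomp : ∀ e : Fin k → Fin n, Measurable fun t : Fin n → ℝ => t ∘ e :=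
    fun e => measurable_pi_lambda _ fun i => measurable_pi_apply (e i)
  calc (n.factorial : ℝ≥0∞) *
        ∑ ι : {ι : Fin k → Fin n // StrictMono ι}, ∫⁻ t in simplexSet n, g (t ∘ ι.1)
      = n.factorial * ∫⁻ t, {t | StrictMono t}.indicator (fun t => ∑ e : Fin k ↪ Fin n,
          {s | StrictMono s}.indicator g (t ∘ e)) t ∂cubeMeasure n := by
        rw [← lintegral_finsetSum _ fun ι _ => (by exact hg.comp (hcomp ι.1)),
          setLIntegral_simplexSet]
        congr 2
        exact Set.indicator_congr (s := {t : Fin n → ℝ | StrictMono t})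
          fun t ht => sum_strictMono_comp g ht
    _ = ∫⁻ t, ∑ e : Fin k ↪ Fin n, {s | StrictMono s}.indicator g (t ∘ e) ∂cubeMeasure n := by
        refine factorial_mul_lintegral_indicator_strictMono
          (Finset.measurable_sum _ fun e _ => hF.comp (hcomp e)) fun σ t => ?_
        exact Fintype.sum_equiv (Equiv.embeddingCongr (Equiv.refl _) σ) _ _ fun e => rfl
    _ = n.descFactorial k * ∫⁻ s in simplexSet k, g s := by
        have he : ∀ e : Fin k ↪ Fin n,
            ∫⁻ t, {s | StrictMono s}.indicator g (t ∘ e) ∂cubeMeasure n =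
              ∫⁻ s in simplexSet k, g s := fun e => by
          rw [setLIntegral_simplexSet]
          exact (measurePreserving_comp_injective _ e.injective).lintegral_comp hF
        rw [lintegral_finsetSum _ fun (e : Fin k ↪ Fin n) _ => (by exact hF.comp (hcomp e))]
        simp [he, Fintype.card_embedding_eq]

/-- **The fundamental example is thinning invariant.**
Given a Borel measurable family `κ` of probability measures on a compact metric space `𝒳`,
indexed by `t ∈ [0,1]` (a Markov kernel), the sequence of measures
`μ_n(A₁×⋯×A_n) = n! ∫_{Δⁿ} ∏ᵢ κ_{tᵢ}(Aᵢ) dt₁⋯dt_n` is thinning invariant. -/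
theorem kernel_mixture_thinning_invariant
    {X : Type*} [MetricSpace X] [CompactSpace X] [MeasurableSpace X] [BorelSpace X]
    (κ : ℝ → Measure X)
    (hκprob : ∀ t, IsProbabilityMeasure (κ t))
    (hκmeas : ∀ B : Set X, MeasurableSet B → Measurable fun t => κ t B)
    (μ : (n : ℕ) → Measure (Fin n → X))
    (hμprob : ∀ n, 1 ≤ n → IsProbabilityMeasure (μ n))
    (hμ : ∀ n, 1 ≤ n → ∀ A : Fin n → Set X, (∀ i, MeasurableSet (A i)) →
      μ n (Set.univ.pi A) =
        (Nat.factorial n : ℝ≥0∞) *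
          ∫⁻ t in simplexSet n, ∏ i, κ (t i) (A i) ∂volume) :
    ∀ k n, 1 ≤ k → k ≤ n → thinTrans k n (μ n) = μ k := by
  classical
  intro k n hk hkn
  have := hμprob k hk
  have hbox : ∀ B : Fin k → Set X, (∀ i, MeasurableSet (B i)) →
      μ k (Set.univ.pi B) = thinTrans k n (μ n) (Set.univ.pi B) := by
    intro B hB
    have hcomp : ∀ ι : Fin k → Fin n, Measurable fun x : Fin n → X => x ∘ ι :=
      fun ι => measurable_pi_lambda _ fun i => measurable_pi_apply (ι i)
    have hg : Measurable fun s : Fin k → ℝ => ∏ i, κ (s i) (B i) :=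
      Finset.measurable_prod _ fun i _ => (hκmeas _ (hB i)).comp (measurable_pi_apply i)
    have hterm : ∀ ι : {ι : Fin k → Fin n // StrictMono ι},
        Measure.map (fun x => x ∘ ι.1) (μ n) (Set.univ.pi B) =
          n.factorial * ∫⁻ t in simplexSet n, ∏ i, κ ((t ∘ ι.1) i) (B i) := fun ι => by
      rw [Measure.map_apply (hcomp _) (MeasurableSet.univ_pi hB),
        preimage_comp_univ_pi ι.2.injective,
        hμ n (hk.trans hkn) _ (measurableSet_extend_univ ι.2.injective hB)]
      simp_rw [fun t : Fin n → ℝ =>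
        prod_measure_extend_univ ι.2.injective (fun j => κ (t j)) B, Function.comp_apply]
    have hchoose : (n.choose k : ℝ≥0∞) ≠ 0 := by
      exact_mod_cast (Nat.choose_pos hkn).ne'
    rw [thinTrans, Measure.smul_apply, Measure.sum_apply _ (MeasurableSet.univ_pi hB),
      tsum_fintype]
    simp_rw [hterm]
    rw [← Finset.mul_sum, factorial_mul_sum_setLIntegral_comp hg, hμ k hk B hB, smul_eq_mul,
      Nat.descFactorial_eq_factorial_mul_choose, Nat.cast_mul,
      mul_comm (k.factorial : ℝ≥0∞) (n.choose k), mul_assoc, ← mul_assoc (n.choose k : ℝ≥0∞)⁻¹,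
      ENNReal.inv_mul_cancel hchoose (ENNReal.natCast_ne_top _), one_mul]
  refine (ext_of_generate_finite _ generateFrom_pi.symm isPiSystem_pi ?_ ?_).symm
  · rintro _ ⟨B, hB, rfl⟩
    exact hbox B fun i => hB i (Set.mem_univ i)
  · have := hbox (fun _ => Set.univ) fun _ => MeasurableSet.univ
    rwa [Set.pi_univ] at this
end

section
/- Let 𝒳 be a compact metric space and let (μ_n)_{n≥1} be an exchangeable triangular array of Borel probability measures, μ_n on 𝒳^n. Then there exists a unique Borel probability measure P on M₁(𝒳) (with the topology of weak convergence) such that for every n ≥ 1 and all Borel sets A₁,…,A_n ⊆ 𝒳: μ_n(A₁×⋯×A_n) = ∫_{M₁(𝒳)} ∏_{i=1}^n μ(A_i) P(dμ); i.e., each μ_n is the corresponding mixture of n-fold product measures. -/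
open MeasureTheory
open scoped ENNReal

/-- The shuffled thinning transition `T̃^n_k : M₁(𝒳ⁿ) → M₁(𝒳ᵏ)`: the average over all
strictly increasing index maps `ι : Fin k → Fin n` and all permutations `π ∈ S_k` of the
pushforward of `μ` under `x ↦ (j ↦ x (ι (π j)))`. -/
noncomputable def shuffledThinTrans {X : Type*} [MeasurableSpace X] (k n : ℕ)
    (μ : Measure (Fin n → X)) : Measure (Fin k → X) :=
  ((n.choose k * Nat.factorial k : ℝ≥0∞))⁻¹ •
    Measure.sum
      (fun p : {ι : Fin k → Fin n // StrictMono ι} × Equiv.Perm (Fin k) =>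
        Measure.map (fun x j => x (p.1.1 (p.2 j))) μ)

open ProbabilityTheory Filter Topology BoundedContinuousFunction
open scoped NNReal

section Aux

variable {X : Type*} [MetricSpace X] [CompactSpace X] [MeasurableSpace X] [BorelSpace X]

/-- On a compact metric space, the Giry σ-algebra on probability measures is the Borel σ-algebra
of the topology of weak convergence. -/
instance ProbabilityMeasure.borelSpace_of_compactSpace : BorelSpace (ProbabilityMeasure X) := by
  refine ⟨le_antisymm ?_ ?_⟩
  · refine Measurable.comap_le ?_
    let _ : MeasurableSpace (ProbabilityMeasure X) := borel _
    have : BorelSpace (ProbabilityMeasure X) := ⟨rfl⟩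
    change Measurable (fun m : ProbabilityMeasure X => (m : Measure X))
    refine Measurable.measure_of_isPiSystem_of_isProbabilityMeasure
      (borel_eq_generateFrom_isClosed (α := X) ▸ BorelSpace.measurable_eq) isPiSystem_isClosed ?_
    intro F hF
    refine measurable_of_tendsto_metrizable
      (f := fun n (m : ProbabilityMeasure X) => ∫⁻ x, IsClosed.apprSeq hF n x ∂(m : Measure X))
      (fun n => ?_) (tendsto_pi_nhds.2 fun m => HasOuterApproxClosed.tendsto_lintegral_apprSeq hF _)
    exact (ProbabilityMeasure.continuous_lintegral_boundedContinuousFunction _).measurable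
  · let s : Set (Set (ProbabilityMeasure X)) :=
      {U | ∃ (f : X →ᵇ ℝ) (V : Set ℝ), IsOpen V ∧
        (fun m : ProbabilityMeasure X => ∫ x, f x ∂(m : Measure X)) ⁻¹' V = U}
    have hs : (inferInstance : TopologicalSpace (ProbabilityMeasure X)) = .generateFrom s := by
      refine le_antisymm (le_generateFrom ?_) ?_
      · rintro _ ⟨f, V, hV, rfl⟩
        exact hV.preimage (ProbabilityMeasure.continuous_integral_boundedContinuousFunction f)
      · refine continuous_id_iff_le.1 ?_
        let t : TopologicalSpace (ProbabilityMeasure X) := .generateFrom s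
        refine (ProbabilityMeasure.continuous_iff_forall_continuous_integral).2 fun f => ?_
        exact ⟨fun V hV => TopologicalSpace.isOpen_generateFrom_of_mem ⟨f, V, hV, rfl⟩⟩
    rw [borel_eq_generateFrom_of_subbasis hs]
    refine MeasurableSpace.generateFrom_le ?_
    rintro _ ⟨f, V, hV, rfl⟩
    have : Measurable fun m : ProbabilityMeasure X => ∫ x, f x ∂(m : Measure X) :=
      (f.continuous.stronglyMeasurable.integral_kernel
        (κ := ⟨fun m : ProbabilityMeasure X => (m : Measure X),
          measurable_subtype_coe⟩)).measurable
    exact this hV.measurableSet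

lemma map_perm_shuffledThinTrans {Y : Type*} [MeasurableSpace Y] {k n : ℕ}
    (μ : Measure (Fin n → Y)) (σ : Equiv.Perm (Fin k)) :
    (shuffledThinTrans k n μ).map (fun x j => x (σ j)) = shuffledThinTrans k n μ := by
  unfold shuffledThinTrans
  have hσ : Measurable fun (x : Fin k → Y) j => x (σ j) := by fun_prop
  rw [Measure.map_smul, Measure.map_sum hσ.aemeasurable]
  congr 1
  ext s hs
  rw [Measure.sum_apply _ hs, Measure.sum_apply _ hs]
  conv_rhs => rw [← ((Equiv.refl {ι : Fin k → Fin n // StrictMono ι}).prodCongr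
    (Equiv.mulRight σ)).tsum_eq]
  refine tsum_congr fun p => ?_
  rw [Measure.map_map hσ (by fun_prop)]
  rfl

lemma map_comp_injective {Y : Type*} [MeasurableSpace Y] {k n : ℕ}
    (μ : Measure (Fin n → Y)) (ν : Measure (Fin k → Y)) [IsProbabilityMeasure μ]
    [IsProbabilityMeasure ν] (hμ : shuffledThinTrans n n μ = μ) (hν : shuffledThinTrans k n μ = ν)
    {φ : Fin k → Fin n} (hφ : Function.Injective φ) :
    μ.map (fun x j => x (φ j)) = ν := by
  have key (ψ : Fin k → Fin n) (hψ : Function.Injective ψ) :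
      μ.map (fun x j => x (ψ j)) = μ.map (fun x j => x (φ j)) := by
    obtain ⟨σ, hσ⟩ := Equiv.Perm.exists_extending_pair φ ψ hφ hψ
    have h := map_perm_shuffledThinTrans (k := n) μ σ
    rw [hμ] at h
    conv_rhs => rw [← h]
    rw [Measure.map_map (by fun_prop) (by fun_prop)]
    simp [Function.comp_def, hσ]
  have : IsProbabilityMeasure (μ.map (fun x j => x (φ j))) :=
    Measure.isProbabilityMeasure_map
      (measurable_pi_lambda _ fun j => measurable_pi_apply (φ j)).aemeasurable
  have hsum (s : Set (Fin k → Y)) (hs : MeasurableSet s) : ν s =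
      shuffledThinTrans k n μ Set.univ * μ.map (fun x j => x (φ j)) s := by
    have (p : {ι : Fin k → Fin n // StrictMono ι} × Equiv.Perm (Fin k)) :=
      key (fun j => p.1.1 (p.2 j)) (p.1.2.injective.comp p.2.injective)
    rw [← hν]
    simp only [shuffledThinTrans, this, Measure.smul_apply, Measure.sum_apply _ hs,
      Measure.sum_apply _ MeasurableSet.univ, measure_univ, smul_eq_mul, mul_assoc,
      ← ENNReal.tsum_mul_right, one_mul]
  ext s hs
  rw [hsum s hs, hν, measure_univ, one_mul]

/-- The empirical measure of a finite nonempty family of points. -/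
noncomputable def empiricalMeasure {Y : Type*} [MeasurableSpace Y] {N : ℕ} [NeZero N]
    (x : Fin N → Y) : ProbabilityMeasure Y :=
  ⟨(N : ℝ≥0∞)⁻¹ • ∑ i, Measure.dirac (x i), ⟨by
    simp [ENNReal.inv_mul_cancel (Nat.cast_ne_zero.2 (NeZero.ne N)) (ENNReal.natCast_ne_top N)]⟩⟩

lemma measurable_empiricalMeasure {Y : Type*} [MeasurableSpace Y] {N : ℕ} [NeZero N] :
    Measurable (empiricalMeasure : (Fin N → Y) → ProbabilityMeasure Y) := by
  refine Measurable.subtype_mk (Measure.measurable_of_measurable_coe _ fun s hs => ?_)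
  simp only [Measure.smul_apply, Measure.finsetSum_apply, smul_eq_mul]
  refine Measurable.const_mul (Finset.measurable_fun_sum _ fun i _ => ?_) _
  exact (Measure.measurable_coe hs).comp (Measure.measurable_dirac.comp (measurable_pi_apply i))

lemma integral_empiricalMeasure {N : ℕ} [NeZero N] (x : Fin N → X) (f : X →ᵇ ℝ) :
    ∫ y, f y ∂(empiricalMeasure x : Measure X) = (N : ℝ)⁻¹ * ∑ i, f (x i) := by
  change ∫ y, f y ∂((N : ℝ≥0∞)⁻¹ • ∑ i, Measure.dirac (x i)) = _
  rw [integral_smul_measure, integral_finsetSum_measure fun i _ => f.integrable _]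
  simp

lemma card_filter_not_injective (n N : ℕ) :
    (((Finset.univ.filter fun φ : Fin n → Fin N => ¬ Function.Injective φ).card : ℕ) : ℝ) =
      (N : ℝ) ^ n - N.descFactorial n := by
  have h := Finset.card_filter_add_card_filter_not (s := (Finset.univ : Finset (Fin n → Fin N)))
    (fun φ => Function.Injective φ)
  have h' : (Finset.univ.filter fun φ : Fin n → Fin N => Function.Injective φ).card =
      N.descFactorial n := by
    rw [← Fintype.card_subtype,
      Fintype.card_congr (Equiv.subtypeInjectiveEquivEmbedding (Fin n) (Fin N)),
      Fintype.card_embedding_eq, Fintype.card_fin, Fintype.card_fin]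
  rw [h', Finset.card_univ, Fintype.card_fun, Fintype.card_fin, Fintype.card_fin] at h
  rw [eq_sub_iff_add_eq']
  exact_mod_cast h

lemma continuous_prod_integral {X : Type*} [MetricSpace X] [MeasurableSpace X] [BorelSpace X]
    {n : ℕ} (f : Fin n → X →ᵇ ℝ) :
    Continuous fun m : ProbabilityMeasure X => ∏ i, ∫ x, f i x ∂(m : Measure X) :=
  continuous_finsetProd _ fun i _ =>
    ProbabilityMeasure.continuous_integral_boundedContinuousFunction (f i)

lemma abs_prod_apply_le {X : Type*} [MetricSpace X] {n : ℕ} (f : Fin n → X →ᵇ ℝ)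
    (x : Fin n → X) :
    |∏ i, f i (x i)| ≤ ∏ i, ‖f i‖ := by
  rw [Finset.abs_prod]
  exact Finset.prod_le_prod (fun _ _ => abs_nonneg _) fun i _ => (f i).norm_coe_le_norm _

lemma abs_integral_prod_apply_le {X Ω : Type*} [MetricSpace X] [MeasurableSpace Ω] (μ : Measure Ω)
    [IsProbabilityMeasure μ] {n : ℕ} (f : Fin n → X →ᵇ ℝ) (x : Ω → Fin n → X) :
    |∫ ω, ∏ i, f i (x ω i) ∂μ| ≤ ∏ i, ‖f i‖ := by
  have := norm_integral_le_of_norm_le_const (μ := μ) (f := fun ω => ∏ i, f i (x ω i))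
    (C := ∏ i, ‖f i‖) (ae_of_all _ fun ω => abs_prod_apply_le f (x ω))
  simpa using this

lemma measurable_prod_apply {X : Type*} [MetricSpace X] [MeasurableSpace X]
    [BorelSpace X] {n : ℕ} (f : Fin n → X →ᵇ ℝ) :
    Measurable fun x : Fin n → X => ∏ i, f i (x i) :=
  Finset.measurable_fun_prod _ fun i _ =>
    (f i).continuous.measurable.comp (measurable_pi_apply i)

/-- The moments of the empirical measure of `N` exchangeable points approximate the
finite-dimensional marginals. -/
lemma abs_integral_map_empiricalMeasure_sub_le {n N : ℕ} [NeZero N]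
    (μ : Measure (Fin N → X)) (ν : Measure (Fin n → X)) [IsProbabilityMeasure μ]
    [IsProbabilityMeasure ν]
    (h : ∀ φ : Fin n → Fin N, Function.Injective φ → μ.map (fun x j => x (φ j)) = ν)
    (f : Fin n → X →ᵇ ℝ) :
    |∫ m, ∏ i, ∫ x, f i x ∂(m : Measure X) ∂(μ.map empiricalMeasure) -
      ∫ x, ∏ i, f i (x i) ∂ν| ≤
      2 * (∏ i, ‖f i‖) * (1 - N.descFactorial n / (N : ℝ) ^ n) := by
  classical
  have hN : (0 : ℝ) < N := Nat.cast_pos.2 (NeZero.pos N)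
  set C := ∏ i, ‖f i‖ with hC
  set I := ∫ x, ∏ i, f i (x i) ∂ν with hI
  have hproj (φ : Fin n → Fin N) : Measurable fun (x : Fin N → X) j => x (φ j) :=
    measurable_pi_lambda _ fun j => measurable_pi_apply (φ j)
  have hE : ∫ m, ∏ i, ∫ x, f i x ∂(m : Measure X) ∂(μ.map empiricalMeasure) =
      ((N : ℝ) ^ n)⁻¹ * ∑ φ : Fin n → Fin N, ∫ x, ∏ i, f i (x (φ i)) ∂μ := by
    rw [integral_map measurable_empiricalMeasure.aemeasurable
      (continuous_prod_integral f).measurable.aestronglyMeasurable]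
    simp only [integral_empiricalMeasure, Finset.prod_mul_distrib, Finset.prod_const,
      Finset.card_univ, Fintype.card_fin, Finset.prod_univ_sum, Fintype.piFinset_univ]
    rw [integral_const_mul, integral_finsetSum, inv_pow]
    intro φ _
    refine Integrable.of_bound ((measurable_prod_apply f).comp (hproj φ)).aestronglyMeasurable
      C (ae_of_all _ fun x => abs_prod_apply_le f _)
  have hsub : ((N : ℝ) ^ n)⁻¹ * ∑ φ : Fin n → Fin N, ∫ x, ∏ i, f i (x (φ i)) ∂μ - I =
      ((N : ℝ) ^ n)⁻¹ * ∑ φ : Fin n → Fin N, (∫ x, ∏ i, f i (x (φ i)) ∂μ - I) := by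
    rw [Finset.sum_sub_distrib, mul_sub]
    congr 1
    simp
    field_simp
  have hterm (φ : Fin n → Fin N) : |∫ x, ∏ i, f i (x (φ i)) ∂μ - I| ≤
      if ¬ Function.Injective φ then 2 * C else 0 := by
    by_cases hφ : Function.Injective φ
    swap
    · rw [if_pos hφ]
      calc _ ≤ |∫ x, ∏ i, f i (x (φ i)) ∂μ| + |I| := abs_sub _ _
        _ ≤ C + C := add_le_add (abs_integral_prod_apply_le μ f fun x i => x (φ i))
          (abs_integral_prod_apply_le ν f fun x => x)
        _ = 2 * C := by ring
    · rw [if_neg (not_not.2 hφ), hI, ← h φ hφ, integral_map (hproj φ).aemeasurable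
        (measurable_prod_apply f).aestronglyMeasurable, sub_self, abs_zero]
  rw [hE, hsub, abs_mul, abs_of_pos (by positivity)]
  calc _ ≤ ((N : ℝ) ^ n)⁻¹ * ∑ φ : Fin n → Fin N,
        (if ¬ Function.Injective φ then 2 * C else 0) := by
        gcongr
        exact (Finset.abs_sum_le_sum_abs _ _).trans (Finset.sum_le_sum fun φ _ => hterm φ)
    _ = _ := by
        rw [← Finset.sum_filter, Finset.sum_const, nsmul_eq_mul, card_filter_not_injective]
        field_simp

/-- The mixture of `n`-fold product measures directed by a law on probability measures. -/
noncomputable def productMixture {Y : Type*} [MeasurableSpace Y] (n : ℕ)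
    (P : Measure (ProbabilityMeasure Y)) : Measure (Fin n → Y) :=
  P.bind fun m => Measure.pi fun _ => (m : Measure Y)

lemma measurable_pi_const {Y : Type*} [MeasurableSpace Y] (n : ℕ) :
    Measurable fun m : ProbabilityMeasure Y => Measure.pi fun _ : Fin n => (m : Measure Y) := by
  refine Measurable.measure_of_isPiSystem_of_isProbabilityMeasure generateFrom_pi.symm
    isPiSystem_pi ?_
  rintro _ ⟨A, hA, rfl⟩
  simp only [Measure.pi_pi]
  exact Finset.measurable_fun_prod _ fun i _ =>
    (Measure.measurable_coe (hA i trivial)).comp measurable_subtype_coe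

instance {Y : Type*} [MeasurableSpace Y] (n : ℕ)
    (P : Measure (ProbabilityMeasure Y)) [IsProbabilityMeasure P] :
    IsProbabilityMeasure (productMixture n P) :=
  isProbabilityMeasure_bind (measurable_pi_const n).aemeasurable (ae_of_all _ fun _ => inferInstance)

lemma productMixture_pi {Y : Type*} [MeasurableSpace Y] {n : ℕ}
    (P : Measure (ProbabilityMeasure Y)) {A : Fin n → Set Y} (hA : ∀ i, MeasurableSet (A i)) :
    productMixture n P (Set.univ.pi A) = ∫⁻ m, ∏ i, (m : Measure Y) (A i) ∂P := by
  rw [productMixture, Measure.bind_apply (MeasurableSet.univ_pi hA)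
    (measurable_pi_const n).aemeasurable]
  simp only [Measure.pi_pi]

lemma integral_productMixture {n : ℕ} (P : Measure (ProbabilityMeasure X))
    [IsProbabilityMeasure P] (f : Fin n → X →ᵇ ℝ) :
    ∫ x, ∏ i, f i (x i) ∂(productMixture n P) =
      ∫ m, ∏ i, ∫ x, f i x ∂(m : Measure X) ∂P := by
  have : IsProbabilityMeasure
      (((⟨_, measurable_pi_const (Y := X) n⟩ : Kernel _ _) ∘ₖ Kernel.const Unit P) ()) :=
    inferInstanceAs (IsProbabilityMeasure (productMixture n P))
  have h := Kernel.integral_comp (κ := Kernel.const Unit P) (a := ())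
    (η := ⟨_, measurable_pi_const (Y := X) n⟩)
    (f := fun x => ∏ i, f i (x i)) ?_
  · refine h.trans (integral_congr_ae (ae_of_all _ fun m => ?_))
    exact integral_fintype_prod_eq_prod fun i => f i
  · exact Integrable.of_bound (measurable_prod_apply f).aestronglyMeasurable (∏ i, ‖f i‖)
      (ae_of_all _ fun x => abs_prod_apply_le f x)

lemma Measure.ext_of_integral_prod_boundedContinuousFunction {X : Type*} [MetricSpace X]
    [MeasurableSpace X] [BorelSpace X] {n : ℕ} {μ ν : Measure (Fin n → X)}
    [IsFiniteMeasure μ] [IsFiniteMeasure ν]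
    (h : ∀ f : Fin n → X →ᵇ ℝ, ∫ x, ∏ i, f i (x i) ∂μ = ∫ x, ∏ i, f i (x i) ∂ν) : μ = ν := by
  have hm : Measurable fun x : Fin n → X => (x, ()) := by fun_prop
  have key : μ.map (fun x => (x, ())) = ν.map (fun x => (x, ())) := by
    refine _root_.Measure.ext_of_integral_prod_mul_boundedContinuousFunction fun f g => ?_
    have hmeas : Measurable fun p : (Fin n → X) × Unit => (∏ i, f i (p.1 i)) * g p.2 :=
      ((measurable_prod_apply f).comp measurable_fst).mul
        (g.continuous.measurable.comp measurable_snd)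
    rw [integral_map hm.aemeasurable hmeas.aestronglyMeasurable,
      integral_map hm.aemeasurable hmeas.aestronglyMeasurable]
    simp only [integral_mul_const, h]
  have := congrArg (Measure.map Prod.fst) key
  simpa [Measure.map_map measurable_fst hm, Function.comp_def] using this

/-- Integration against a fixed bounded continuous function, as a bounded continuous function on
the compact space of probability measures. -/
noncomputable def integralBCF (f : X →ᵇ ℝ) : ProbabilityMeasure X →ᵇ ℝ :=
  BoundedContinuousFunction.mkOfCompact
    ⟨fun m => ∫ x, f x ∂(m : Measure X),
      ProbabilityMeasure.continuous_integral_boundedContinuousFunction f⟩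

@[simp]
lemma integralBCF_apply (f : X →ᵇ ℝ) (m : ProbabilityMeasure X) :
    integralBCF f m = ∫ x, f x ∂(m : Measure X) := rfl

/-- The subalgebra generated by the functionals `integralBCF f`. -/
noncomputable def integralSubalgebra (X : Type*) [MetricSpace X] [CompactSpace X]
    [MeasurableSpace X] [BorelSpace X] : StarSubalgebra ℝ (ProbabilityMeasure X →ᵇ ℝ) where
  __ := Algebra.adjoin ℝ (Set.range integralBCF)
  star_mem' := fun {a} ha => by
    have : star a = a := by ext; simp
    rwa [this]

lemma separatesPoints_integralSubalgebra :
    ((integralSubalgebra X).map (toContinuousMapStarₐ ℝ)).SeparatesPoints := by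
  intro m m' hne
  by_contra! hcon
  refine hne (ProbabilityMeasure.toMeasure_injective
    (ext_of_forall_integral_eq_of_IsFiniteMeasure fun f => ?_))
  exact hcon _ ⟨_, ⟨integralBCF f, Algebra.subset_adjoin ⟨f, rfl⟩, rfl⟩, rfl⟩

lemma eq_of_productMixture_eq {P Q : Measure (ProbabilityMeasure X)} [IsProbabilityMeasure P]
    [IsProbabilityMeasure Q] (h : ∀ n, 1 ≤ n → productMixture n P = productMixture n Q) :
    P = Q := by
  let _ : MetricSpace (ProbabilityMeasure X) := TopologicalSpace.metrizableSpaceMetric _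
  refine ext_of_forall_mem_subalgebra_integral_eq_of_pseudoEMetric_complete_countable
    separatesPoints_integralSubalgebra fun g hg => ?_
  replace hg : g ∈ Algebra.adjoin ℝ (Set.range integralBCF) := hg
  rw [← Subalgebra.mem_toSubmodule, Algebra.adjoin_eq_span] at hg
  induction hg using Submodule.span_induction with
  | mem g hg =>
    obtain ⟨l, hl, rfl⟩ := Submonoid.exists_list_of_mem_closure hg
    obtain ⟨l, rfl⟩ : l ∈ Set.range (List.map integralBCF) := by
      rwa [Set.range_list_map]
    rcases Nat.eq_zero_or_pos l.length with h0 | h0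
    · simp [List.length_eq_zero_iff.1 h0]
    · have hprod (m : ProbabilityMeasure X) : (l.map integralBCF).prod m =
          ∏ i : Fin l.length, ∫ x, l.get i x ∂(m : Measure X) := by
        refine Eq.trans ?_ (Fin.prod_univ_fun_getElem l fun f => ∫ x, f x ∂(m : Measure X)).symm
        clear hl h0 hg
        induction l with
        | nil => rfl
        | cons f l ih => simp [ih]
      simp only [hprod]
      rw [← integral_productMixture, ← integral_productMixture, h _ h0]
  | zero => simp
  | add g g' _ _ hg hg' =>
    simp only [BoundedContinuousFunction.coe_add, Pi.add_apply]
    rw [integral_add (g.integrable _) (g'.integrable _),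
      integral_add (g.integrable _) (g'.integrable _), hg, hg']
  | smul c g _ hg =>
    simp only [BoundedContinuousFunction.coe_smul, integral_smul, hg]

lemma tendsto_descFactorial_div_pow (n : ℕ) :
    Tendsto (fun N : ℕ => (N.descFactorial n : ℝ) / (N : ℝ) ^ n) atTop (𝓝 1) := by
  refine (Asymptotics.isEquivalent_iff_tendsto_one ?_).1 (isEquivalent_descFactorial n)
  filter_upwards [eventually_ne_atTop 0] with N hN
  positivity

lemma exists_eq_productMixture (μ : (n : ℕ) → Measure (Fin n → X))
    (hprob : ∀ n, 1 ≤ n → IsProbabilityMeasure (μ n))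
    (hexch : ∀ k n, 1 ≤ k → k ≤ n → shuffledThinTrans k n (μ n) = μ k) :
    ∃ P : Measure (ProbabilityMeasure X), IsProbabilityMeasure P ∧
      ∀ n, 1 ≤ n → μ n = productMixture n P := by
  have hprob' (N : ℕ) : IsProbabilityMeasure (μ (N + 1)) := hprob _ N.succ_pos
  let Q (N : ℕ) : ProbabilityMeasure (ProbabilityMeasure X) :=
    ⟨(μ (N + 1)).map empiricalMeasure,
      Measure.isProbabilityMeasure_map measurable_empiricalMeasure.aemeasurable⟩
  obtain ⟨P, -, hP⟩ := isCompact_univ.ultrafilter_le_nhds ((hyperfilter ℕ).map Q)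
    (by simp)
  replace hP : Tendsto Q (hyperfilter ℕ) (𝓝 P) := hP
  refine ⟨P, inferInstance, fun n hn => ?_⟩
  have := hprob n hn
  refine Measure.ext_of_integral_prod_boundedContinuousFunction fun f => ?_
  rw [integral_productMixture]
  have h₁ := ProbabilityMeasure.tendsto_iff_forall_integral_tendsto.1 hP
    (BoundedContinuousFunction.mkOfCompact ⟨_, continuous_prod_integral f⟩)
  refine tendsto_nhds_unique ?_ h₁
  rw [tendsto_iff_norm_sub_tendsto_zero]
  have h₂ : Tendsto (fun N : ℕ => 2 * (∏ i, ‖f i‖) *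
      (1 - ((N + 1).descFactorial n : ℝ) / ((N + 1 : ℕ) : ℝ) ^ n)) (hyperfilter ℕ) (𝓝 0) := by
    have := ((tendsto_const_nhds (x := (1 : ℝ))).sub
      ((tendsto_add_atTop_iff_nat 1).2 (tendsto_descFactorial_div_pow n))).const_mul
      (2 * ∏ i, ‖f i‖)
    simpa using this.mono_left Nat.hyperfilter_le_atTop
  refine squeeze_zero (fun _ => norm_nonneg _) (fun N => ?_) h₂
  refine abs_integral_map_empiricalMeasure_sub_le (μ (N + 1)) (μ n) (fun φ hφ => ?_) f
  have hle : n ≤ N + 1 := by simpa using Fintype.card_le_of_injective φ hφ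
  exact map_comp_injective _ _ (hexch _ _ N.succ_pos le_rfl) (hexch _ _ hn hle) hφ

lemma eq_productMixture_iff {Y : Type*} [MeasurableSpace Y] {n : ℕ} (μ : Measure (Fin n → Y))
    [IsProbabilityMeasure μ] (P : Measure (ProbabilityMeasure Y)) [IsProbabilityMeasure P] :
    μ = productMixture n P ↔ ∀ A : Fin n → Set Y, (∀ i, MeasurableSet (A i)) →
      μ (Set.univ.pi A) = ∫⁻ m, ∏ i, m (A i) ∂(P.map ((↑) : ProbabilityMeasure Y → Measure Y)) := by
  have key (A : Fin n → Set Y) (hA : ∀ i, MeasurableSet (A i)) :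
      ∫⁻ m, ∏ i, m (A i) ∂(P.map ((↑) : ProbabilityMeasure Y → Measure Y)) =
        productMixture n P (Set.univ.pi A) := by
    rw [productMixture_pi P hA]
    exact lintegral_map (Finset.measurable_fun_prod _ fun i _ => Measure.measurable_coe (hA i))
      measurable_subtype_coe
  refine ⟨fun h A hA => by rw [key A hA, ← h], fun h => ?_⟩
  refine ext_of_generate_finite _ generateFrom_pi.symm isPiSystem_pi ?_ (by simp)
  rintro _ ⟨A, hA, rfl⟩
  have hA' : ∀ i, MeasurableSet (A i) := fun i => hA i trivial
  rw [h A hA', key A hA']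

lemma exists_map_coe_eq {Y : Type*} [MeasurableSpace Y] (ρ : Measure (Measure Y))
    [IsProbabilityMeasure ρ] (hρ : ρ {m : Measure Y | IsProbabilityMeasure m}ᶜ = 0) :
    ∃ P : Measure (ProbabilityMeasure Y), IsProbabilityMeasure P ∧
      P.map ((↑) : ProbabilityMeasure Y → Measure Y) = ρ := by
  have he : MeasurableEmbedding (Subtype.val : ProbabilityMeasure Y → Measure Y) :=
    MeasurableEmbedding.subtype_coe ProbabilityMeasure.measurableSet_isProbabilityMeasure
  have hmap : (ρ.comap Subtype.val).map (Subtype.val : ProbabilityMeasure Y → Measure Y) = ρ := by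
    rw [he.map_comap]
    refine Measure.restrict_eq_self_of_ae_mem ?_
    have : ∀ᵐ m ∂ρ, m ∈ {m : Measure Y | IsProbabilityMeasure m} := hρ
    filter_upwards [this] with m hm using ⟨⟨m, hm⟩, rfl⟩
  have huniv : (ρ.comap Subtype.val).map (Subtype.val : ProbabilityMeasure Y → Measure Y)
      Set.univ = 1 := by rw [hmap, measure_univ]
  rw [he.map_apply, Set.preimage_univ] at huniv
  exact ⟨ρ.comap Subtype.val, ⟨huniv⟩, hmap⟩

end Aux

/-- **de Finetti's theorem for exchangeable triangular arrays.**
If `(μ_n)` is an exchangeable triangular array (`T̃^n_k μ_n = μ_k` for `k ≤ n`) of Borel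
probability measures on powers of a compact metric space `𝒳`, then there is a unique
Borel probability measure `P` on `M₁(𝒳)` such that each `μ_n` is the `P`-mixture of
`n`-fold product measures: `μ_n(A₁×⋯×A_n) = ∫ ∏ᵢ m(Aᵢ) dP(m)`. -/
theorem deFinetti_triangular_array
    {X : Type*} [MetricSpace X] [CompactSpace X] [MeasurableSpace X] [BorelSpace X]
    (μ : (n : ℕ) → Measure (Fin n → X))
    (hprob : ∀ n, 1 ≤ n → IsProbabilityMeasure (μ n))
    (hexch : ∀ k n, 1 ≤ k → k ≤ n → shuffledThinTrans k n (μ n) = μ k) :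
    ∃! P : Measure (Measure X),
      IsProbabilityMeasure P ∧
      P {m : Measure X | IsProbabilityMeasure m}ᶜ = 0 ∧
      (∀ n, 1 ≤ n → ∀ A : Fin n → Set X, (∀ i, MeasurableSet (A i)) →
        μ n (Set.univ.pi A) = ∫⁻ m, (∏ i, m (A i)) ∂P) := by
  obtain ⟨P, hP, hμ⟩ := exists_eq_productMixture μ hprob hexch
  have hcoe : Measurable ((↑) : ProbabilityMeasure X → Measure X) := measurable_subtype_coe
  refine ⟨P.map (↑), ⟨Measure.isProbabilityMeasure_map hcoe.aemeasurable, ?_, fun n hn => ?_⟩, ?_⟩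
  · rw [Measure.map_apply hcoe ProbabilityMeasure.measurableSet_isProbabilityMeasure.compl]
    convert measure_empty (μ := P)
    ext m
    simpa using (inferInstance : IsProbabilityMeasure (m : Measure X))
  · have := hprob n hn
    exact (eq_productMixture_iff (μ n) P).1 (hμ n hn)
  · rintro R ⟨hR, hR0, hRμ⟩
    obtain ⟨Q, hQ, rfl⟩ := exists_map_coe_eq R hR0
    rw [eq_of_productMixture_eq (P := Q) (Q := P) fun n hn => ?_]
    have := hprob n hn
    rw [← hμ n hn, ← (eq_productMixture_iff (μ n) Q).2 (hRμ n hn)]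
end

section
/- Fix integers 1 ≤ k ≤ n. For N ≥ n and K ∈ {1,…,N} let p(N,K;n,k) = C(K−1,k−1)·C(N−K,n−k)/C(N,n) (the probability that a uniformly random increasing n-subset of {1,…,N} has its k-th element equal to K), and let Φ_{k,n−k+1}(t) = t^{k−1}(1−t)^{n−k}/B(k,n−k+1) be the Beta(k, n−k+1) density, where B(k,n−k+1) = (k−1)!(n−k)!/n!. Then lim_{N→∞} Σ_{K=1}^N | p(N,K;n,k) − N⁻¹ Φ_{k,n−k+1}(K/N) | = 0. -/
open Filter

/-- If `m / N` is within `d / N` of `x`, then the normalized falling factorial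
`m (m - 1) ⋯ (m - a + 1) / N ^ a` is within `a (a + d) / N` of `x ^ a`. -/
theorem abs_descFactorial_div_pow_sub_pow_le {m N : ℕ} {x d : ℝ} (hN : 0 < N) (hm : m ≤ N)
    (hx0 : 0 ≤ x) (hx1 : x ≤ 1) (h : |(m : ℝ) / N - x| ≤ d / N) (a : ℕ) :
    |(m.descFactorial a : ℝ) / (N : ℝ) ^ a - x ^ a| ≤ a * (a + d) / N := by
  have hN' : (0 : ℝ) < N := by exact_mod_cast hN
  induction a with
  | zero => simp
  | succ a ih =>
    set q := (m.descFactorial a : ℝ) / (N : ℝ) ^ a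
    set y := ((m - a : ℕ) : ℝ) / N with hy
    have hq : (m.descFactorial (a + 1) : ℝ) / (N : ℝ) ^ (a + 1) = q * y := by
      rw [Nat.descFactorial_succ]; push_cast; simp only [q, y]; field_simp; ring
    have hy0 : 0 ≤ y := by positivity
    have hy1 : y ≤ 1 := by
      rw [hy, div_le_one hN']; exact_mod_cast (Nat.sub_le m a).trans hm
    have hym : |y - (m : ℝ) / N| ≤ a / N := by
      rw [hy, ← sub_div, abs_div, abs_of_pos hN']
      gcongr
      have h1 : ((m - a : ℕ) : ℝ) ≤ m := by exact_mod_cast Nat.sub_le m a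
      have h2 : (m : ℝ) ≤ (m - a : ℕ) + a := by exact_mod_cast (by omega : m ≤ m - a + a)
      rw [abs_le]; constructor <;> linarith
    have hyx : |y - x| ≤ (a + d) / N := by
      calc |y - x| ≤ |y - (m : ℝ) / N| + |(m : ℝ) / N - x| := abs_sub_le _ _ _
        _ ≤ a / N + d / N := add_le_add hym h
        _ = (a + d) / N := by ring
    rw [hq]
    calc |q * y - x ^ (a + 1)| = |(q - x ^ a) * y + x ^ a * (y - x)| := by ring_nf
      _ ≤ |q - x ^ a| * y + x ^ a * |y - x| := by
        refine (abs_add_le _ _).trans_eq ?_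
        rw [abs_mul, abs_mul, abs_of_nonneg hy0, abs_of_nonneg (pow_nonneg hx0 a)]
      _ ≤ |q - x ^ a| * 1 + 1 * |y - x| := by
        gcongr
        exact pow_le_one₀ hx0 hx1
      _ ≤ a * (a + d) / N + (a + d) / N := by linarith
      _ ≤ (a + 1 : ℕ) * ((a + 1 : ℕ) + d) / N := by
        rw [← add_div]
        gcongr
        push_cast
        nlinarith [(Nat.cast_nonneg a : (0 : ℝ) ≤ a)]

/-- A perturbation bound for a quotient `q r / s` near `u v / 1`. -/
theorem abs_mul_div_sub_mul_le {q r s u v A B S : ℝ} (hr0 : 0 ≤ r) (hr1 : r ≤ 1)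
    (hu0 : 0 ≤ u) (hu1 : u ≤ 1) (hv0 : 0 ≤ v) (hv1 : v ≤ 1) (hs : 1 / 2 ≤ s)
    (hq : |q - u| ≤ A) (hr : |r - v| ≤ B) (hsS : |s - 1| ≤ S) :
    |q * r / s - u * v| ≤ 2 * (A + B + S) := by
  have hs0 : 0 < s := by linarith
  have key : |q * r - u * v * s| ≤ A + B + S := by
    calc |q * r - u * v * s| = |(q - u) * r + u * (r - v) - u * v * (s - 1)| := by ring_nf
      _ ≤ |(q - u) * r| + |u * (r - v)| + |u * v * (s - 1)| :=
        (abs_sub _ _).trans (add_le_add_left (abs_add_le _ _) _)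
      _ = |q - u| * r + u * |r - v| + u * v * |s - 1| := by
        rw [abs_mul, abs_mul, abs_mul (u * v), abs_of_nonneg hr0, abs_of_nonneg hu0,
          abs_of_nonneg (mul_nonneg hu0 hv0)]
      _ ≤ |q - u| * 1 + 1 * |r - v| + 1 * |s - 1| := by
        gcongr
        exact mul_le_one₀ hu1 hv0 hv1
      _ ≤ A + B + S := by linarith
  have : q * r / s - u * v = (q * r - u * v * s) / s := by field_simp
  rw [this, abs_div, abs_of_pos hs0, div_le_iff₀ hs0]
  nlinarith [abs_nonneg (q * r - u * v * s)]

/-- Uniform bound on the difference between a subsampling weight and the Beta density, in the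
parameters `a = k - 1`, `b = n - k`. -/
theorem abs_subsampling_weight_sub_beta_density_le {a b N K : ℕ} (hK : 1 ≤ K) (hKN : K ≤ N)
    (hN : 2 * (a + b + 1) ^ 2 ≤ N) :
    |(((K - 1).choose a * (N - K).choose b : ℕ) : ℝ) / (N.choose (a + b + 1) : ℝ) -
        (N : ℝ)⁻¹ * (((K : ℝ) / N) ^ a * (1 - (K : ℝ) / N) ^ b /
          ((a.factorial * b.factorial : ℝ) / ((a + b + 1).factorial : ℝ)))| ≤
      ((a + b + 1).factorial : ℝ) / (a.factorial * b.factorial) *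
        (2 * (a * (a + 1) + b * b + (a + b + 1) * (a + b + 1))) / (N : ℝ) ^ 2 := by
  have hNpos : 0 < N := by omega
  have hN' : (0 : ℝ) < N := by exact_mod_cast hNpos
  have hKN' : (K : ℝ) ≤ N := by exact_mod_cast hKN
  set x := (K : ℝ) / N with hx
  have hx0 : 0 ≤ x := by positivity
  have hx1 : x ≤ 1 := (div_le_one hN').2 hKN'
  set q := ((K - 1).descFactorial a : ℝ) / (N : ℝ) ^ a with hq
  set r := ((N - K).descFactorial b : ℝ) / (N : ℝ) ^ b with hr
  set s := (N.descFactorial (a + b + 1) : ℝ) / (N : ℝ) ^ (a + b + 1) with hs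
  have hqx : |q - x ^ a| ≤ a * (a + 1) / N := by
    refine abs_descFactorial_div_pow_sub_pow_le hNpos (by omega) hx0 hx1 ?_ a
    rw [hx, ← sub_div, Nat.cast_sub hK, abs_div, abs_of_pos hN']
    simp
  have hrx : |r - (1 - x) ^ b| ≤ b * b / N := by
    have := abs_descFactorial_div_pow_sub_pow_le (x := 1 - x) (d := 0) (m := N - K) hNpos
      (by omega) (by linarith) (by linarith)
      (by rw [Nat.cast_sub hKN, sub_div, div_self hN'.ne']; simp [hx]) b
    simpa using this
  have hs1 : |s - 1| ≤ (a + b + 1) * (a + b + 1) / N := by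
    have := abs_descFactorial_div_pow_sub_pow_le (x := 1) (d := 0) hNpos le_rfl zero_le_one le_rfl
      (by simp [hN'.ne']) (a + b + 1)
    simpa only [one_pow, add_zero, Nat.cast_add, Nat.cast_one] using this
  have hsmall : ((a : ℝ) + b + 1) * (a + b + 1) / N ≤ 1 / 2 := by
    rw [div_le_iff₀ hN']
    have : (2 : ℝ) * (a + b + 1) ^ 2 ≤ N := by exact_mod_cast hN
    linarith
  have hs2 : 1 / 2 ≤ s := by linarith [(abs_le.1 hs1).1]
  have hr1 : r ≤ 1 := by
    rw [hr, div_le_one (by positivity)]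
    exact_mod_cast (Nat.descFactorial_le_pow _ _).trans (Nat.pow_le_pow_left (Nat.sub_le N K) b)
  have main := abs_mul_div_sub_mul_le (by positivity) hr1 (pow_nonneg hx0 a)
    (pow_le_one₀ hx0 hx1) (pow_nonneg (sub_nonneg.2 hx1) b)
    (pow_le_one₀ (sub_nonneg.2 hx1) (by linarith)) hs2 hqx hrx hs1
  set c := ((a + b + 1).factorial : ℝ) / (a.factorial * b.factorial) with hc
  have hc0 : 0 ≤ c := by positivity
  have choose_eq : ∀ m j : ℕ, (m.choose j : ℝ) = (m.descFactorial j : ℝ) / j.factorial := by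
    intro m j
    rw [Nat.descFactorial_eq_factorial_mul_choose, Nat.cast_mul,
      mul_div_cancel_left₀ _ (by positivity)]
  have hDne : (N.descFactorial (a + b + 1) : ℝ) ≠ 0 := by
    intro h
    rw [hs, h, zero_div] at hs2
    norm_num at hs2
  have hp : (((K - 1).choose a * (N - K).choose b : ℕ) : ℝ) / (N.choose (a + b + 1) : ℝ) =
      c / N * (q * r / s) := by
    rw [Nat.cast_mul, choose_eq, choose_eq, choose_eq, hc, hq, hr, hs]
    field_simp
    ring
  have hphi : (N : ℝ)⁻¹ * (x ^ a * (1 - x) ^ b /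
      ((a.factorial * b.factorial : ℝ) / ((a + b + 1).factorial : ℝ))) =
      c / N * (x ^ a * (1 - x) ^ b) := by
    rw [hc]
    field_simp
  rw [hp, hphi, ← mul_sub, abs_mul, abs_of_nonneg (by positivity : 0 ≤ c / N)]
  refine (mul_le_mul_of_nonneg_left main (by positivity)).trans_eq ?_
  field_simp

/-- **Convergence of the subsampling weights to the Beta density.**
Fix `1 ≤ k ≤ n`. Let `p(N,K;n,k) = C(K−1,k−1)·C(N−K,n−k)/C(N,n)` be the probability that
a uniformly random increasing `n`-subset of `{1,…,N}` has `k`-th element equal to `K`, and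
let `Φ_{k,n−k+1}(t) = t^{k−1}(1−t)^{n−k}/B(k,n−k+1)` be the `Beta(k, n−k+1)` density, where
`B(k,n−k+1) = (k−1)!(n−k)!/n!`. Then
`Σ_{K=1}^N | p(N,K;n,k) − N⁻¹ Φ_{k,n−k+1}(K/N) | → 0` as `N → ∞`. -/
theorem subsampling_weights_tendsto_beta_density
    (n k : ℕ) (hk : 1 ≤ k) (hkn : k ≤ n) :
    Tendsto
      (fun N : ℕ => ∑ K ∈ Finset.Icc 1 N,
        |(((K - 1).choose (k - 1) * (N - K).choose (n - k) : ℕ) : ℝ) / (N.choose n : ℝ) -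
          (N : ℝ)⁻¹ *
            (((K : ℝ) / N) ^ (k - 1) * (1 - (K : ℝ) / N) ^ (n - k) /
              ((Nat.factorial (k - 1) * Nat.factorial (n - k) : ℝ) / (Nat.factorial n : ℝ)))|)
      atTop (nhds 0) := by
  obtain ⟨a, rfl⟩ := Nat.exists_eq_add_of_le' hk
  obtain ⟨b, rfl⟩ := Nat.exists_eq_add_of_le hkn
  simp only [Nat.add_sub_cancel, Nat.add_sub_cancel_left]
  rw [Nat.add_right_comm a 1 b]
  set M : ℝ := ((a + b + 1).factorial : ℝ) / (a.factorial * b.factorial) *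
    (2 * (a * (a + 1) + b * b + (a + b + 1) * (a + b + 1))) with hM
  refine squeeze_zero' (Eventually.of_forall fun N => Finset.sum_nonneg fun _ _ => abs_nonneg _)
    ?_ (tendsto_const_div_atTop_nhds_zero_nat M)
  filter_upwards [eventually_ge_atTop (2 * (a + b + 1) ^ 2), eventually_gt_atTop 0] with N hN hN0
  have hN' : (N : ℝ) ≠ 0 := by exact_mod_cast hN0.ne'
  refine (Finset.sum_le_card_nsmul _ _ (M / (N : ℝ) ^ 2) fun K hK => ?_).trans_eq ?_
  · rw [Finset.mem_Icc] at hK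
    exact abs_subsampling_weight_sub_beta_density_le hK.1 hK.2 hN
  · rw [Nat.card_Icc, Nat.add_sub_cancel, nsmul_eq_mul]
    field_simp
end

section
/- Let N ≥ 2 be an integer and let ρ be a probability measure on {−1,+1}^N. Define the relative entropy S_N(ρ) = −Σ_{σ∈{−1,+1}^N} ρ({σ}) log(2^N ρ({σ})) (with 0·log 0 = 0), and for k ≤ N let T^N_k ρ be the thinning of ρ: (T^N_k ρ)(A) = C(N,k)⁻¹ Σ_{1≤i₁<⋯<i_k≤N} ρ({σ : (σ_{i₁},…,σ_{i_k}) ∈ A}). Then for every k with 1 ≤ k ≤ N−1: S_N(ρ) ≤ S_k(T^N_k ρ) + S_{N−k}(T^N_{N−k} ρ). -/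
open scoped Classical in
/-- The finset of strictly increasing maps `Fin n → Fin m`. -/
noncomputable def strictMonoMaps (n m : ℕ) : Finset (Fin n → Fin m) :=
  Finset.univ.filter StrictMono

open scoped Classical in
/-- The thinning `T^N_k ρ` of a probability mass function `ρ` on `{−1,+1}^N`:
`(T^N_k ρ)(τ) = C(N,k)⁻¹ Σ_{i₁<⋯<i_k} ρ({σ : (σ_{i₁},…,σ_{i_k}) = τ})`. -/
noncomputable def thinPmf (N k : ℕ) (ρ : (Fin N → ℤˣ) → ℝ)
    (τ : Fin k → ℤˣ) : ℝ :=
  ((N.choose k : ℝ))⁻¹ *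
    ∑ ι ∈ strictMonoMaps k N, ∑ σ : Fin N → ℤˣ, if σ ∘ ι = τ then ρ σ else 0

/-- The entropy of a probability mass function on `{−1,+1}^m` relative to the uniform
measure: `S_m(ρ) = −Σ_σ ρ(σ) log(2^m ρ(σ))` (with `0·log 0 = 0`). -/
noncomputable def relEntropy (m : ℕ) (ρ : (Fin m → ℤˣ) → ℝ) : ℝ :=
  -∑ σ : Fin m → ℤˣ, ρ σ * Real.log (2 ^ m * ρ σ)

theorem mem_strictMonoMaps {n m : ℕ} {ι : Fin n → Fin m} :
    ι ∈ strictMonoMaps n m ↔ StrictMono ι := by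
  simp [strictMonoMaps]

theorem exists_strictMono_range_eq {n m : ℕ} (s : Finset (Fin m)) (hs : s.card = n) :
    ∃ ι ∈ strictMonoMaps n m, Set.range ι = s :=
  ⟨s.orderEmbOfFin hs, mem_strictMonoMaps.2 (s.orderEmbOfFin hs).strictMono,
    s.range_orderEmbOfFin hs⟩

theorem card_strictMonoMaps (n m : ℕ) : (strictMonoMaps n m).card = m.choose n := by
  classical
  have h : (Finset.powersetCard n (Finset.univ : Finset (Fin m))).card = m.choose n := by simp
  rw [← h]
  refine Finset.card_bij (fun ι _ => Finset.univ.image ι) ?_ ?_ ?_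
  · intro ι hι
    rw [mem_strictMonoMaps] at hι
    simp [Finset.mem_powersetCard, Finset.card_image_of_injective _ hι.injective]
  · intro ι hι κ hκ hικ
    rw [mem_strictMonoMaps] at hι hκ
    refine (hι.range_inj hκ).1 ?_
    simpa using congrArg (fun s : Finset (Fin m) => (s : Set (Fin m))) hικ
  · intro s hs
    obtain ⟨ι, hι, hr⟩ := exists_strictMono_range_eq s (Finset.mem_powersetCard.1 hs).2
    exact ⟨ι, hι, Finset.coe_injective (by simpa using hr)⟩

/-- Every strictly increasing map has a strictly increasing map enumerating the complement
of its range. -/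
theorem exists_strictMono_range_compl {a b N : ℕ} (hab : a + b = N) (ι : Fin a → Fin N)
    (hι : ι ∈ strictMonoMaps a N) :
    ∃ κ ∈ strictMonoMaps b N, Set.range κ = (Set.range ι)ᶜ := by
  classical
  rw [mem_strictMonoMaps] at hι
  obtain ⟨κ, hκ, hr⟩ := exists_strictMono_range_eq (n := b) (Finset.univ.image ι)ᶜ (by
    rw [Finset.card_compl, Finset.card_image_of_injective _ hι.injective]
    simp
    omega)
  exact ⟨κ, hκ, by simpa using hr⟩

theorem sum_thinPmf_mul {N k : ℕ} (ρ : (Fin N → ℤˣ) → ℝ) (g : (Fin k → ℤˣ) → ℝ) :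
    ∑ τ, thinPmf N k ρ τ * g τ =
      (N.choose k : ℝ)⁻¹ * ∑ ι ∈ strictMonoMaps k N, ∑ σ, ρ σ * g (σ ∘ ι) := by
  classical
  simp only [thinPmf, mul_assoc, ← Finset.mul_sum, Finset.sum_mul]
  congr 1
  rw [Finset.sum_comm]
  refine Finset.sum_congr rfl fun ι _ => ?_
  rw [Finset.sum_comm]
  refine Finset.sum_congr rfl fun σ _ => ?_
  simp [ite_mul]

theorem thinPmf_nonneg {N k : ℕ} {ρ : (Fin N → ℤˣ) → ℝ} (hρ : ∀ σ, 0 ≤ ρ σ)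
    (τ : Fin k → ℤˣ) : 0 ≤ thinPmf N k ρ τ := by
  refine mul_nonneg (by positivity) (Finset.sum_nonneg fun ι _ => Finset.sum_nonneg fun σ _ => ?_)
  split_ifs
  exacts [hρ σ, le_rfl]

theorem thinPmf_comp_pos {N k : ℕ} {ρ : (Fin N → ℤˣ) → ℝ} (hρ : ∀ σ, 0 ≤ ρ σ)
    {σ : Fin N → ℤˣ} (hσ : 0 < ρ σ) {ι : Fin k → Fin N} (hι : ι ∈ strictMonoMaps k N) :
    0 < thinPmf N k ρ (σ ∘ ι) := by
  have hnn : ∀ (κ : Fin k → Fin N) (σ' : Fin N → ℤˣ),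
      0 ≤ if σ' ∘ κ = σ ∘ ι then ρ σ' else 0 := fun κ σ' => by
    split_ifs
    exacts [hρ σ', le_rfl]
  have hc : 0 < N.choose k := card_strictMonoMaps k N ▸ Finset.card_pos.2 ⟨ι, hι⟩
  unfold thinPmf
  refine mul_pos (by positivity) (Finset.sum_pos' (fun κ _ => Finset.sum_nonneg fun σ' _ => ?_)
    ⟨ι, hι, Finset.sum_pos' (fun σ' _ => ?_) ⟨σ, Finset.mem_univ σ, ?_⟩⟩)
  · convert hnn κ σ'
  · convert hnn ι σ'
  · simpa using hσ

theorem sum_thinPmf {N k : ℕ} (hkN : k ≤ N) {ρ : (Fin N → ℤˣ) → ℝ} (hρ1 : ∑ σ, ρ σ = 1) :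
    ∑ τ, thinPmf N k ρ τ = 1 := by
  have h := sum_thinPmf_mul (k := k) ρ (fun _ => 1)
  have hc : (N.choose k : ℝ) ≠ 0 := by exact_mod_cast (Nat.choose_pos hkN).ne'
  simpa [hρ1, card_strictMonoMaps, hc] using h

theorem sum_comp_mul_comp {α : Type*} [Fintype α] {a b N : ℕ}
    {ι : Fin a → Fin N} {κ : Fin b → Fin N} (hι : Function.Injective ι)
    (hκ : Function.Injective κ) (hr : Set.range κ = (Set.range ι)ᶜ)
    (P : (Fin a → α) → ℝ) (Q : (Fin b → α) → ℝ) :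
    ∑ σ : Fin N → α, P (σ ∘ ι) * Q (σ ∘ κ) = (∑ τ, P τ) * ∑ τ, Q τ := by
  have hbij : Function.Bijective (Sum.elim ι κ) := by
    refine ⟨hι.sumElim hκ fun i j hij => ?_, ?_⟩
    · have hj : κ j ∈ (Set.range ι)ᶜ := hr ▸ Set.mem_range_self j
      exact hj ⟨i, hij⟩
    · rw [← Set.range_eq_univ, Set.Sum.elim_range, hr, Set.union_compl_self]
  rw [Fintype.sum_mul_sum, ← Fintype.sum_prod_type']
  exact Fintype.sum_equiv
    (((Equiv.ofBijective _ hbij).symm.arrowCongr (Equiv.refl α)).trans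
      (Equiv.sumArrowEquivProdArrow _ _ _)) _ _ fun σ => rfl

theorem sub_add_mul_log_le_mul_log {x y c : ℝ} (hc : 0 < c) (hx : 0 ≤ x) (hy : 0 ≤ y)
    (hxy : 0 < x → 0 < y) :
    x - y + x * Real.log (c * y) ≤ x * Real.log (c * x) := by
  rcases hx.eq_or_lt with rfl | hx
  · simpa using hy
  · have hy' := hxy hx
    have h := mul_le_mul_of_nonneg_left (Real.log_le_sub_one_of_pos (div_pos hy' hx)) hx.le
    rw [Real.log_div hy'.ne' hx.ne', mul_sub, mul_sub, mul_div_cancel₀ _ hx.ne'] at h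
    rw [Real.log_mul hc.ne' hy'.ne', Real.log_mul hc.ne' hx.ne']
    linarith

/-- Gibbs' inequality for `ρ` against the product of its two thinnings placed on
complementary coordinates. -/
theorem sum_mul_log_thinPmf_le {a b N : ℕ} (hab : a + b = N) {ρ : (Fin N → ℤˣ) → ℝ}
    (hρ0 : ∀ σ, 0 ≤ ρ σ) (hρ1 : ∑ σ, ρ σ = 1) {ι : Fin a → Fin N} {κ : Fin b → Fin N}
    (hι : ι ∈ strictMonoMaps a N) (hκ : κ ∈ strictMonoMaps b N)
    (hr : Set.range κ = (Set.range ι)ᶜ) :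
    ∑ σ, ρ σ * Real.log (2 ^ a * thinPmf N a ρ (σ ∘ ι)) +
      ∑ σ, ρ σ * Real.log (2 ^ b * thinPmf N b ρ (σ ∘ κ)) ≤
      ∑ σ, ρ σ * Real.log (2 ^ N * ρ σ) := by
  have hprod := sum_comp_mul_comp (mem_strictMonoMaps.1 hι).injective
    (mem_strictMonoMaps.1 hκ).injective hr (thinPmf N a ρ) (thinPmf N b ρ)
  rw [sum_thinPmf (by omega) hρ1, sum_thinPmf (by omega) hρ1] at hprod
  have hsum : ∑ σ, (ρ σ - thinPmf N a ρ (σ ∘ ι) * thinPmf N b ρ (σ ∘ κ) +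
      (ρ σ * Real.log (2 ^ a * thinPmf N a ρ (σ ∘ ι)) +
        ρ σ * Real.log (2 ^ b * thinPmf N b ρ (σ ∘ κ)))) ≤
      ∑ σ, ρ σ * Real.log (2 ^ N * ρ σ) := by
    refine Finset.sum_le_sum fun σ _ => ?_
    refine le_trans (le_of_eq ?_) (sub_add_mul_log_le_mul_log (c := 2 ^ N) (by positivity) (hρ0 σ)
      (mul_nonneg (thinPmf_nonneg hρ0 (σ ∘ ι)) (thinPmf_nonneg hρ0 (σ ∘ κ)))
      fun h => mul_pos (thinPmf_comp_pos hρ0 h hι) (thinPmf_comp_pos hρ0 h hκ))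
    rcases (hρ0 σ).eq_or_lt with h | h
    · simp [← h]
    · have hP := thinPmf_comp_pos hρ0 h hι
      have hQ := thinPmf_comp_pos hρ0 h hκ
      rw [← mul_add, ← Real.log_mul (by positivity) (by positivity), mul_mul_mul_comm,
        ← pow_add, hab]
  rw [Finset.sum_add_distrib, Finset.sum_sub_distrib, Finset.sum_add_distrib, hρ1, hprod] at hsum
  linarith

theorem relEntropy_le_of_add_eq {a b N : ℕ} (hab : a + b = N) {ρ : (Fin N → ℤˣ) → ℝ}
    (hρ0 : ∀ σ, 0 ≤ ρ σ) (hρ1 : ∑ σ, ρ σ = 1) :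
    relEntropy N ρ ≤ relEntropy a (thinPmf N a ρ) + relEntropy b (thinPmf N b ρ) := by
  have hba : b + a = N := by omega
  choose c hc hcr using exists_strictMono_range_compl hab
  have hreindex : ∀ f : (Fin b → Fin N) → ℝ,
      ∑ ι ∈ (strictMonoMaps a N).attach, f (c ι.1 ι.2) = ∑ κ ∈ strictMonoMaps b N, f κ := by
    intro f
    refine Finset.sum_bij (fun ι _ => c ι.1 ι.2) (fun ι _ => hc _ _) ?_ ?_ fun _ _ => rfl
    · rintro ⟨ι, hι⟩ - ⟨κ, hκ⟩ - h
      have h' := congrArg Set.range h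
      simp only [hcr, compl_inj_iff] at h'
      exact Subtype.ext (((mem_strictMonoMaps.1 hι).range_inj (mem_strictMonoMaps.1 hκ)).1 h')
    · intro κ hκ
      obtain ⟨ι, hι, hr⟩ := exists_strictMono_range_compl hba κ hκ
      refine ⟨⟨ι, hι⟩, Finset.mem_attach _ _, ?_⟩
      refine ((mem_strictMonoMaps.1 (hc ι hι)).range_inj (mem_strictMonoMaps.1 hκ)).1 ?_
      rw [hcr, hr, compl_compl]
  have hC : (N.choose b : ℝ) = N.choose a := by
    rw [← hab, Nat.choose_symm_add]
  have hpos : (0 : ℝ) < N.choose a := by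
    exact_mod_cast Nat.choose_pos (by omega)
  have hsum := Finset.sum_le_sum fun (ι : {ι // ι ∈ strictMonoMaps a N})
      (_ : ι ∈ (strictMonoMaps a N).attach) =>
    sum_mul_log_thinPmf_le hab hρ0 hρ1 ι.2 (hc ι.1 ι.2) (hcr ι.1 ι.2)
  rw [Finset.sum_add_distrib, Finset.sum_const, Finset.card_attach, card_strictMonoMaps,
    nsmul_eq_mul,
    hreindex fun κ => ∑ σ, ρ σ * Real.log (2 ^ b * thinPmf N b ρ (σ ∘ κ)),
    Finset.sum_attach (strictMonoMaps a N)
      fun ι => ∑ σ, ρ σ * Real.log (2 ^ a * thinPmf N a ρ (σ ∘ ι))] at hsum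
  unfold relEntropy
  rw [sum_thinPmf_mul ρ fun τ => Real.log (2 ^ a * thinPmf N a ρ τ),
    sum_thinPmf_mul ρ fun τ => Real.log (2 ^ b * thinPmf N b ρ τ), hC, ← neg_add, ← mul_add,
    neg_le_neg_iff, inv_mul_le_iff₀ hpos]
  exact hsum

/-- **Subadditivity of the entropy under complementary thinnings.** For a probability
measure `ρ` on `{−1,+1}^N` and `1 ≤ k ≤ N−1`:
`S_N(ρ) ≤ S_k(T^N_k ρ) + S_{N−k}(T^N_{N−k} ρ)`. -/
theorem entropy_subadditive_thinning
    (N : ℕ) (hN : 2 ≤ N) (ρ : (Fin N → ℤˣ) → ℝ)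
    (hρ0 : ∀ σ, 0 ≤ ρ σ) (hρ1 : ∑ σ, ρ σ = 1)
    (k : ℕ) (hk : 1 ≤ k) (hkN : k ≤ N - 1) :
    relEntropy N ρ ≤
      relEntropy k (thinPmf N k ρ) + relEntropy (N - k) (thinPmf N (N - k) ρ) := by
  exact relEntropy_le_of_add_eq (by omega) hρ0 hρ1
end
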